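/- There is a universal constant C such that for every weighted connected graph G = (V,E,w) with n = |V| ≥ 4 vertices there exists a spanning tree T of G, a subgraph of G, with avestretch'(T, E) ≤ C · (log n)^2 · log log n · min_{T'} avestretch'(T', E), where the minimum is over all spanning trees T' of G that are subgraphs of G; in particular, since avestretch'(T', E) ≥ 1 for every such T', it suffices that avestretch'(T, E) ≤ C · (log n)^2 · log log n. -/

import Mathlib

open scoped Classical

structure WGraph (V : Type) (E : Type) where
  ends : E → V × V
  w : E → ℝ
  w_pos : ∀ e, 0 < w e

namespace WGraph

variable {V E : Type}

/-- The length of an edge is the reciprocal of its weight. -/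
noncomputable def len (G : WGraph V E) (e : E) : ℝ := 1 / G.w e

/-- A walk in a multigraph, recorded as a sequence of edge traversals. -/
inductive Walk (G : WGraph V E) : V → V → Type
  | nil (v : V) : Walk G v v
  | cons (u v x : V) (e : E)
      (h : G.ends e = (u, v) ∨ G.ends e = (v, u))
      (p : Walk G v x) : Walk G u x

/-- The length of a walk: the sum of the lengths of its edges. -/
noncomputable def Walk.length {G : WGraph V E} : ∀ {u v : V}, G.Walk u v → ℝ
  | _, _, .nil _ => 0
  | _, _, .cons _ _ _ e _ p => G.len e + Walk.length p

/-- The list of vertices visited by a walk. -/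
def Walk.support {G : WGraph V E} : ∀ {u v : V}, G.Walk u v → List V
  | _, _, .nil v => [v]
  | _, _, .cons u _ _ _ _ p => u :: Walk.support p

def Connected (G : WGraph V E) : Prop := ∀ u v : V, Nonempty (G.Walk u v)

/-- Shortest-path distance. -/
noncomputable def dist (G : WGraph V E) (u v : V) : ℝ :=
  sInf {l | ∃ p : G.Walk u v, p.length = l}

/-- Shortest-path distance inside the subgraph induced on `A`. -/
noncomputable def distOn (G : WGraph V E) (A : Set V) (u v : V) : ℝ :=
  sInf {l | ∃ p : G.Walk u v, (∀ z ∈ p.support, z ∈ A) ∧ p.length = l}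

/-- The distance from a vertex to a set of vertices. -/
noncomputable def distToSet (G : WGraph V E) (u : V) (S : Set V) : ℝ :=
  sInf {l | ∃ s ∈ S, G.dist u s = l}

/-- The distance from a vertex to a set, within the subgraph induced on `A`. -/
noncomputable def distToSetOn (G : WGraph V E) (A : Set V) (u : V) (S : Set V) : ℝ :=
  sInf {l | ∃ s ∈ S, G.distOn A u s = l}

/-- radius(G,x): the smallest `r` such that every vertex is within distance `r` of `x`. -/
noncomputable def radius (G : WGraph V E) (x : V) : ℝ :=
  sInf {r | ∀ v : V, G.dist x v ≤ r}

/-- The radius of the subgraph induced on `A`, about `x`. -/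
noncomputable def radiusOn (G : WGraph V E) (A : Set V) (x : V) : ℝ :=
  sInf {r | ∀ v ∈ A, G.distOn A x v ≤ r}

/-- The subgraph induced on `A` is connected. -/
def ConnectedOn (G : WGraph V E) (A : Set V) : Prop :=
  ∀ u ∈ A, ∀ v ∈ A, ∃ p : G.Walk u v, ∀ z ∈ p.support, z ∈ A

/-- The spanning subgraph with edge set `T`. -/
def restrictE (G : WGraph V E) (T : Set E) : WGraph V T where
  ends e := G.ends e.1
  w e := G.w e.1
  w_pos e := G.w_pos e.1

/-- `T` is the edge set of a spanning tree of `G` (a subgraph of `G`). -/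
def IsSpanningTree [Fintype V] (G : WGraph V E) (T : Finset E) : Prop :=
  (G.restrictE (T : Set E)).Connected ∧ T.card + 1 = Fintype.card V

/-- stretch_T(u,v) = dist_T(u,v)/d(u,v) for the edge e = (u,v). -/
noncomputable def stretch (G : WGraph V E) (T : Finset E) (e : E) : ℝ :=
  (G.restrictE (T : Set E)).dist (G.ends e).1 (G.ends e).2 / G.len e

/-- The average stretch over all edges. -/
noncomputable def avestretch [Fintype E] (G : WGraph V E) (T : Finset E) : ℝ :=
  (∑ e : E, G.stretch T e) / (Fintype.card E : ℝ)

/-- The Alon–Karp–Peleg–West stretch: dist_T(u,v)/dist_G(u,v). -/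
noncomputable def stretchAKPW (G : WGraph V E) (T : Finset E) (e : E) : ℝ :=
  (G.restrictE (T : Set E)).dist (G.ends e).1 (G.ends e).2 /
    G.dist (G.ends e).1 (G.ends e).2

/-- The average AKPW stretch over all edges. -/
noncomputable def avestretchAKPW [Fintype E] (G : WGraph V E) (T : Finset E) : ℝ :=
  (∑ e : E, G.stretchAKPW T e) / (Fintype.card E : ℝ)

/-- The ball of radius `r` around `x`. -/
def ball (G : WGraph V E) (r : ℝ) (x : V) : Set V := {v | G.dist x v ≤ r}

/-- The ball shell of radius `r` around `x`. -/
def ballShell (G : WGraph V E) (r : ℝ) (x : V) : Set V :=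
  {u | u ∉ G.ball r x ∧ ∃ e : E, ∃ z ∈ G.ball r x,
    (G.ends e = (u, z) ∨ G.ends e = (z, u)) ∧ G.dist x u = G.dist x z + G.len e}

/-- The set of edges with exactly one endpoint in `S`. -/
def bdry (G : WGraph V E) (S : Set V) : Set E :=
  {e | ((G.ends e).1 ∈ S ∧ (G.ends e).2 ∉ S) ∨ ((G.ends e).1 ∉ S ∧ (G.ends e).2 ∈ S)}

/-- The set of edges with both endpoints in `S`. -/
def edgesIn (G : WGraph V E) (S : Set V) : Set E :=
  {e | (G.ends e).1 ∈ S ∧ (G.ends e).2 ∈ S}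

/-- The set of edges with one endpoint in `S` and the other in `T`. -/
def edgesBetween (G : WGraph V E) (S T : Set V) : Set E :=
  {e | ((G.ends e).1 ∈ S ∧ (G.ends e).2 ∈ T) ∨ ((G.ends e).1 ∈ T ∧ (G.ends e).2 ∈ S)}

/-- vol(S): the number of edges with at least one endpoint in `S`. -/
noncomputable def volV (G : WGraph V E) (S : Set V) : ℕ :=
  {e : E | (G.ends e).1 ∈ S ∨ (G.ends e).2 ∈ S}.ncard

/-- cost(F): the sum of the weights of the edges in `F`. -/
noncomputable def cost [Fintype E] (G : WGraph V E) (F : Set E) : ℝ :=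
  ∑ e : E, F.indicator G.w e

/-- A star-decomposition of `G` with center `x0`, parts `P i`, anchors `x i`,
`y i ∈ P 0`, and bridge edges `b i` for `i ≠ 0`. -/
structure IsStarDecomp (G : WGraph V E) (x0 : V) (k : ℕ)
    (P : Fin (k + 1) → Set V) (x y : Fin (k + 1) → V)
    (b : Fin (k + 1) → E) : Prop where
  disj : ∀ i j, i ≠ j → Disjoint (P i) (P j)
  cover : ⋃ i, P i = Set.univ
  center : x0 ∈ P 0
  conn : ∀ i, G.ConnectedOn (P i)
  anchor : ∀ i, x i ∈ P i
  x0eq : x 0 = x0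
  bridge : ∀ i, i ≠ 0 → y i ∈ P 0 ∧
    (G.ends (b i) = (x i, y i) ∨ G.ends (b i) = (y i, x i))

/-- A (δ,ε)-star-decomposition. -/
def IsStarDecompDE (G : WGraph V E) (x0 : V) (δ ε : ℝ) (k : ℕ)
    (P : Fin (k + 1) → Set V) (x y : Fin (k + 1) → V)
    (b : Fin (k + 1) → E) : Prop :=
  G.IsStarDecomp x0 k P x y b ∧
  δ * G.radius x0 ≤ G.radiusOn (P 0) x0 ∧
  G.radiusOn (P 0) x0 ≤ (1 - δ) * G.radius x0 ∧
  ∀ i, i ≠ 0 →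
    G.radiusOn (P 0) x0 + G.len (b i) + G.radiusOn (P i) (x i) ≤
      (1 + ε) * G.radius x0

/-- A concentric system in `G` (indexed by nonnegative radii). -/
structure IsConcentric (G : WGraph V E) (L : ℝ → Set V) : Prop where
  nonempty : (L 0).Nonempty
  mono : ∀ r r' : ℝ, 0 ≤ r → r < r' → L r ⊆ L r'
  closed : ∀ r : ℝ, 0 ≤ r → ∀ e : E,
    ((G.ends e).1 ∈ L r → (G.ends e).2 ∈ L (r + G.len e)) ∧
    ((G.ends e).2 ∈ L r → (G.ends e).1 ∈ L (r + G.len e))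

/-- The total length of the traversals of a walk that are not forward
(with respect to `S`). -/
noncomputable def Walk.coneCost {G : WGraph V E} (S : Set V) :
    ∀ {u v : V}, G.Walk u v → ℝ
  | _, _, .nil _ => 0
  | _, _, .cons a c _ e _ p =>
      (if G.distToSet a S + G.len e = G.distToSet c S then 0 else G.len e) +
        Walk.coneCost S p

/-- The cone of width `l` around `v` induced by `S`. -/
def cone (G : WGraph V E) (S : Set V) (l : ℝ) (v : V) : Set V :=
  {u | ∃ p : G.Walk v u, Walk.coneCost S p ≤ l}

/-- `coneCost` computed within the subgraph induced on `A`. -/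
noncomputable def Walk.coneCostOn {G : WGraph V E} (A S : Set V) :
    ∀ {u v : V}, G.Walk u v → ℝ
  | _, _, .nil _ => 0
  | _, _, .cons a c _ e _ p =>
      (if G.distToSetOn A a S + G.len e = G.distToSetOn A c S then 0 else G.len e) +
        Walk.coneCostOn A S p

/-- The cone of width `l` around `v` induced by `S`, computed in the subgraph
induced on `A`. -/
def coneOn (G : WGraph V E) (A S : Set V) (l : ℝ) (v : V) : Set V :=
  {u | ∃ p : G.Walk v u, (∀ z ∈ p.support, z ∈ A) ∧ Walk.coneCostOn A S p ≤ l}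

end WGraph

namespace WGraph

variable {V E : Type}

theorem len_pos (G : WGraph V E) (e : E) : 0 < G.len e := one_div_pos.mpr (G.w_pos e)

theorem Walk.length_nonneg {G : WGraph V E} {u v : V} (p : G.Walk u v) : 0 ≤ p.length := by
  induction p with
  | nil v => exact le_rfl
  | cons u v x e h p ih => exact add_nonneg (G.len_pos e).le ih

theorem Walk.exists_append {G : WGraph V E} {u v x : V} (p : G.Walk u v) (q : G.Walk v x) :
    ∃ r : G.Walk u x, r.length = p.length + q.length := by
  induction p with
  | nil v => exact ⟨q, (zero_add _).symm⟩
  | cons u v x e h p ih =>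
    obtain ⟨r, hr⟩ := ih q
    exact ⟨.cons _ _ _ e h r, by simp only [Walk.length, hr, add_assoc]⟩

theorem Walk.exists_reverse {G : WGraph V E} {u v : V} (p : G.Walk u v) :
    ∃ r : G.Walk v u, r.length = p.length := by
  induction p with
  | nil v => exact ⟨.nil v, rfl⟩
  | cons u v x e h p ih =>
    obtain ⟨r, hr⟩ := ih
    obtain ⟨q, hq⟩ := r.exists_append (.cons v u u e h.symm (.nil u))
    exact ⟨q, by simp only [hq, hr, Walk.length]; ring⟩

theorem bddBelow_walk_lengths (G : WGraph V E) (u v : V) :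
    BddBelow {l | ∃ p : G.Walk u v, p.length = l} :=
  ⟨0, by rintro _ ⟨p, rfl⟩; exact p.length_nonneg⟩

theorem dist_le_length {G : WGraph V E} {u v : V} (p : G.Walk u v) : G.dist u v ≤ p.length :=
  csInf_le (G.bddBelow_walk_lengths u v) ⟨p, rfl⟩

theorem dist_nonneg (G : WGraph V E) (u v : V) : 0 ≤ G.dist u v :=
  Real.sInf_nonneg (by rintro _ ⟨p, rfl⟩; exact p.length_nonneg)

theorem dist_self (G : WGraph V E) (u : V) : G.dist u u = 0 :=
  le_antisymm (dist_le_length (.nil u)) (G.dist_nonneg u u)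

/-- `u` and `v` are the two ends of the edge `e`, in some order. -/
def Joins (G : WGraph V E) (e : E) (u v : V) : Prop :=
  G.ends e = (u, v) ∨ G.ends e = (v, u)

theorem Joins.symm {G : WGraph V E} {e : E} {u v : V} (h : G.Joins e u v) : G.Joins e v u :=
  Or.symm h

theorem joins_ends (G : WGraph V E) (e : E) : G.Joins e (G.ends e).1 (G.ends e).2 := Or.inl rfl

/-- `u` and `v` are joined by a walk of length at most `L` with all its edges in `T`. -/
def JoinedIn (G : WGraph V E) (T : Finset E) (u v : V) (L : ℝ) : Prop :=
  ∃ p : (G.restrictE (T : Set E)).Walk u v, p.length ≤ L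

theorem JoinedIn.refl (G : WGraph V E) (T : Finset E) (u : V) : G.JoinedIn T u u 0 :=
  ⟨.nil u, le_rfl⟩

theorem JoinedIn.symm {G : WGraph V E} {T : Finset E} {u v : V} {L : ℝ}
    (h : G.JoinedIn T u v L) : G.JoinedIn T v u L := by
  obtain ⟨p, hp⟩ := h
  obtain ⟨q, hq⟩ := p.exists_reverse
  exact ⟨q, hq.trans_le hp⟩

theorem JoinedIn.trans {G : WGraph V E} {T : Finset E} {u v x : V} {L M : ℝ}
    (h : G.JoinedIn T u v L) (h' : G.JoinedIn T v x M) : G.JoinedIn T u x (L + M) := by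
  obtain ⟨p, hp⟩ := h
  obtain ⟨q, hq⟩ := h'
  obtain ⟨r, hr⟩ := p.exists_append q
  exact ⟨r, hr.trans_le (add_le_add hp hq)⟩

theorem JoinedIn.le {G : WGraph V E} {T : Finset E} {u v : V} {L M : ℝ}
    (h : G.JoinedIn T u v L) (hLM : L ≤ M) : G.JoinedIn T u v M :=
  h.imp fun _ hp => hp.trans hLM

theorem JoinedIn.of_mem {G : WGraph V E} {T : Finset E} {e : E} {u v : V} (he : e ∈ T)
    (h : G.Joins e u v) : G.JoinedIn T u v (G.len e) :=
  ⟨.cons u v v ⟨e, he⟩ h (.nil v), by simp [Walk.length, len, restrictE]⟩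

theorem JoinedIn.mono {G : WGraph V E} {T T' : Finset E} {u v : V} {L : ℝ}
    (h : G.JoinedIn T u v L) (hT : T ⊆ T') : G.JoinedIn T' u v L := by
  obtain ⟨p, hp⟩ := h
  refine JoinedIn.le (L := p.length) ?_ hp
  clear hp
  induction p with
  | nil v => exact JoinedIn.refl G T' v
  | cons u v x e h p ih => exact (JoinedIn.of_mem (hT e.2) h).trans ih

theorem JoinedIn.dist_le {G : WGraph V E} {T : Finset E} {u v : V} {L : ℝ}
    (h : G.JoinedIn T u v L) : (G.restrictE (T : Set E)).dist u v ≤ L := by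
  obtain ⟨p, hp⟩ := h
  exact (dist_le_length p).trans hp

/-- The values of costs of paths to a vertex, where a path starts at a source `v` with initial
cost `L` given by `src v L` and continues along arcs `u → v` of cost `k` given by `arc u v k`. -/
inductive CostReach (src : V → ℝ → Prop) (arc : V → V → ℝ → Prop) : V → ℝ → Prop
  | src {v : V} {L : ℝ} (h : src v L) : CostReach src arc v L
  | step {u v : V} {L k : ℝ} (h : CostReach src arc u L) (h' : arc u v k) :
      CostReach src arc v (L + k)

theorem CostReach.exists_least {src : V → ℝ → Prop} {arc : V → V → ℝ → Prop}
    (hsrc : {L | ∃ v, src v L}.Finite) (harc : {k | ∃ u v, arc u v k}.Finite)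
    (hsrc0 : ∀ v L, src v L → 0 ≤ L) (harc0 : ∀ u v k, arc u v k → 0 ≤ k)
    {v : V} (hv : ∃ L, CostReach src arc v L) :
    ∃ L, CostReach src arc v L ∧ ∀ L', CostReach src arc v L' → L ≤ L' := by
  set S : Set ℝ := {L | ∃ v, src v L} ∪ {k | ∃ u v, arc u v k} with hS
  have hpwo : (AddSubmonoid.closure S : Set ℝ).IsPWO := by
    refine Set.IsPWO.addSubmonoid_closure ?_ (hsrc.union harc).isPWO
    rintro x (⟨v, h⟩ | ⟨u, v, h⟩)
    exacts [hsrc0 _ _ h, harc0 _ _ _ h]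
  have hsub : ∀ v L, CostReach src arc v L → L ∈ AddSubmonoid.closure S := by
    intro v L h
    induction h with
    | src h => exact AddSubmonoid.subset_closure (Or.inl ⟨_, h⟩)
    | step h h' ih =>
      exact add_mem ih (AddSubmonoid.subset_closure (Or.inr ⟨_, _, h'⟩))
  have hwf : {L | CostReach src arc v L}.IsWF := (hpwo.mono fun L h => hsub v L h).isWF
  exact ⟨hwf.min hv, hwf.min_mem hv, fun L' h => hwf.min_le hv h⟩

theorem CostReach.exists_potential {src : V → ℝ → Prop} {arc : V → V → ℝ → Prop}
    (hsrc : {L | ∃ v, src v L}.Finite) (harc : {k | ∃ u v, arc u v k}.Finite)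
    (hsrc0 : ∀ v L, src v L → 0 ≤ L) (harc0 : ∀ u v k, arc u v k → 0 ≤ k)
    (S : Finset V) (hS : ∀ v ∈ S, ∃ L, CostReach src arc v L) :
    ∃ f : V → ℝ, ∀ v ∈ S, CostReach src arc v (f v) ∧
      ∀ L, CostReach src arc v L → f v ≤ L := by
  choose! f hf using fun v hv => CostReach.exists_least hsrc harc hsrc0 harc0 (hS v hv)
  exact ⟨f, hf⟩

/-- The arcs given by the edges of `G` inside `X`, with cost `k e u v` for the traversal of `e`
from `u` to `v`. -/
def edgeArc (G : WGraph V E) (X : Finset V) (k : E → V → V → ℝ) (u v : V) (x : ℝ) : Prop :=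
  ∃ e, G.Joins e u v ∧ u ∈ X ∧ v ∈ X ∧ x = k e u v

theorem finite_edgeArc [Fintype V] [Fintype E] (G : WGraph V E) (X : Finset V)
    (k : E → V → V → ℝ) : {x | ∃ u v, G.edgeArc X k u v x}.Finite := by
  refine (Set.finite_range fun p : E × V × V => k p.1 p.2.1 p.2.2).subset ?_
  rintro x ⟨u, v, e, -, -, -, rfl⟩
  exact ⟨(e, u, v), rfl⟩

/-- Induction along a function that decreases strictly from every point to some other point. -/
theorem descent_induction {S : Finset V} {x : V} {f : V → ℝ} {p : V → Prop} (hx : p x)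
    (step : ∀ a ∈ S, a ≠ x → ∃ b ∈ S, f b < f a ∧ (p b → p a)) : ∀ a ∈ S, p a := by
  by_contra! h
  obtain ⟨a, haS, ha⟩ := h
  obtain ⟨m, hm, hmin⟩ := (S.filter fun a => ¬ p a).exists_min_image f ⟨a, by simp [haS, ha]⟩
  rw [Finset.mem_filter] at hm
  obtain ⟨b, hbS, hlt, hb⟩ := step m hm.1 (by rintro rfl; exact hm.2 hx)
  by_cases hpb : p b
  · exact hm.2 (hb hpb)
  · exact (hmin b (by simp [hbS, hpb])).not_gt hlt

theorem exists_sum_cut_le {ι : Type} (F : Finset ι) (a b c d : ι → ℝ) (hd : ∀ e, 0 < d e)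
    (hc : ∀ e, 0 ≤ c e) {K : ℝ} (hab : ∀ e ∈ F, b e - a e ≤ K * d e)
    (hK : 0 ≤ K) {p q : ℝ} (hpq : p < q) :
    ∃ r ∈ Set.Ico p q, (∑ e ∈ F with a e ≤ r ∧ r < b e, c e / d e) * (q - p) ≤
      K * ∑ e ∈ F with a e < q ∧ p < b e, c e := by
  let g : ℝ → ℝ := fun r => ∑ e ∈ F, (Set.Ico (a e) (b e)).indicator (fun _ => c e / d e) r
  have hint : ∀ e, MeasureTheory.IntegrableOn
      ((Set.Ico (a e) (b e)).indicator (fun _ => c e / d e)) (Set.Ico p q) := fun e =>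
    (MeasureTheory.integrableOn_const (by simp)).indicator measurableSet_Ico
  obtain ⟨r, hr, hle⟩ := MeasureTheory.exists_le_setAverage (μ := MeasureTheory.volume)
    (s := Set.Ico p q) (f := g) (by simpa using hpq) (by simp)
    (MeasureTheory.integrable_finsetSum F fun e _ => hint e)
  refine ⟨r, hr, ?_⟩
  have hg : g r = ∑ e ∈ F with a e ≤ r ∧ r < b e, c e / d e := by
    simp [g, Finset.sum_filter, Set.indicator_apply]
  rw [← hg]
  have hqp : 0 < q - p := sub_pos.mpr hpq
  rw [MeasureTheory.setAverage_eq, MeasureTheory.integral_finsetSum F fun e _ => hint e] at hle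
  simp only [Real.volume_real_Ico_of_le hpq.le, smul_eq_mul] at hle
  rw [inv_mul_eq_div, le_div_iff₀ hqp] at hle
  refine hle.trans ?_
  rw [Finset.mul_sum, Finset.sum_filter]
  refine Finset.sum_le_sum fun e he => ?_
  rw [MeasureTheory.setIntegral_indicator measurableSet_Ico, MeasureTheory.setIntegral_const,
    smul_eq_mul, Set.Ico_inter_Ico, Real.volume_real_Ico]
  have hcd : 0 ≤ c e / d e := div_nonneg (hc e) (hd e).le
  split_ifs with h
  · have hKc : K * c e = K * d e * (c e / d e) := by
      have := (hd e).ne'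
      field_simp
    rw [hKc]
    refine mul_le_mul_of_nonneg_right (max_le ?_ (mul_nonneg hK (hd e).le)) hcd
    refine le_trans ?_ (hab e he)
    exact sub_le_sub (min_le_right _ _) (le_max_right _ _)
  · have : max (min q (b e) - max p (a e)) 0 = 0 := by
      refine max_eq_right ?_
      rw [not_and_or, not_lt, not_lt] at h
      rcases h with h | h
      · linarith [min_le_left q (b e), le_max_right p (a e)]
      · linarith [min_le_right q (b e), le_max_left p (a e)]
    simp [this]

theorem exists_succ_le_two_mul {u : ℕ → ℝ} {β : ℝ} {N : ℕ} (hN : N ≠ 0) (h0 : β ≤ u 0)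
    (hu : u N ≤ 2 ^ N * β) : ∃ j < N, u (j + 1) ≤ 2 * u j := by
  by_contra! h
  have hle : ∀ j ≤ N, 2 ^ j * β ≤ u j := by
    intro j hj
    induction j with
    | zero => simpa using h0
    | succ j ih =>
      have := h j hj
      have := ih (Nat.le_of_succ_le hj)
      rw [pow_succ]
      linarith
  obtain ⟨M, rfl⟩ := Nat.exists_eq_succ_of_ne_zero hN
  have h1 := h M (Nat.lt_succ_self M)
  have h2 := hle M (Nat.le_succ M)
  rw [Nat.succ_eq_add_one, pow_succ] at hu
  linarith

/-- The edges with both ends in `X`. -/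
noncomputable def inside [Fintype E] (G : WGraph V E) (X : Finset V) : Finset E :=
  {e | (G.ends e).1 ∈ X ∧ (G.ends e).2 ∈ X}

/-- The edges joining `P` to `Q`. -/
noncomputable def across [Fintype E] (G : WGraph V E) (P Q : Finset V) : Finset E :=
  {e | (G.ends e).1 ∈ P ∧ (G.ends e).2 ∈ Q ∨ (G.ends e).1 ∈ Q ∧ (G.ends e).2 ∈ P}

theorem mem_inside [Fintype E] {G : WGraph V E} {X : Finset V} {e : E} :
    e ∈ G.inside X ↔ (G.ends e).1 ∈ X ∧ (G.ends e).2 ∈ X := by simp [inside]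

theorem mem_across [Fintype E] {G : WGraph V E} {P Q : Finset V} {e : E} :
    e ∈ G.across P Q ↔
      (G.ends e).1 ∈ P ∧ (G.ends e).2 ∈ Q ∨ (G.ends e).1 ∈ Q ∧ (G.ends e).2 ∈ P := by
  simp [across]

theorem inside_univ [Fintype V] [Fintype E] (G : WGraph V E) :
    G.inside Finset.univ = Finset.univ := by
  ext e
  simp [mem_inside]

theorem Joins.mem_inside [Fintype E] {G : WGraph V E} {X : Finset V} {e : E} {u v : V}
    (h : G.Joins e u v) (hu : u ∈ X) (hv : v ∈ X) : e ∈ G.inside X := by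
  rw [WGraph.mem_inside]
  rcases h with h | h <;> simp [h, hu, hv]

theorem sum_inside_eq [Fintype E] (G : WGraph V E) {X P : Finset V} (hP : P ⊆ X) (g : E → ℝ) :
    ∑ e ∈ G.inside X, g e = ∑ e ∈ G.inside P, g e + ∑ e ∈ G.inside (X \ P), g e +
      ∑ e ∈ G.across P (X \ P), g e := by
  simp only [inside, across, Finset.sum_filter, ← Finset.sum_add_distrib]
  refine Finset.sum_congr rfl fun e _ => ?_
  have h1 := @hP (G.ends e).1
  have h2 := @hP (G.ends e).2
  by_cases k1 : (G.ends e).1 ∈ P <;> by_cases k2 : (G.ends e).2 ∈ P <;>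
    by_cases k3 : (G.ends e).1 ∈ X <;> by_cases k4 : (G.ends e).2 ∈ X <;> simp_all

/-- The volume of `X`: the total `c`-mass of the edges inside `X`, plus `β` per vertex. -/
noncomputable def mass [Fintype E] (G : WGraph V E) (c : E → ℝ) (β : ℝ) (X : Finset V) : ℝ :=
  β * X.card + ∑ e ∈ G.inside X, c e

/-- The superadditive potential `s ↦ s (1 + log₂ (s / β))`. -/
noncomputable def entropy (β s : ℝ) : ℝ := s * (1 + Real.logb 2 (s / β))

theorem entropy_nonneg {β s : ℝ} (hβ : 0 < β) (hs : β ≤ s) : 0 ≤ entropy β s :=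
  mul_nonneg (hβ.le.trans hs)
    (add_nonneg zero_le_one (Real.logb_nonneg one_lt_two ((one_le_div hβ).mpr hs)))

theorem add_le_entropy_sub {β x y z : ℝ} (hβ : 0 < β) (hx : β ≤ x) (hy : β ≤ y) (hz : 0 ≤ z)
    (hxy : 2 * x ≤ x + y + z) :
    x + z ≤ entropy β (x + y + z) - entropy β x - entropy β y := by
  have hx0 : 0 < x := hβ.trans_le hx
  have hy0 : 0 < y := hβ.trans_le hy
  have h1 : 1 + Real.logb 2 (x / β) ≤ Real.logb 2 ((x + y + z) / β) := by
    rw [← Real.logb_self_eq_one one_lt_two, ← Real.logb_mul (by norm_num) (by positivity)]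
    refine Real.logb_le_logb_of_le one_lt_two (by positivity) ?_
    rw [← mul_div_assoc]
    exact div_le_div_of_nonneg_right hxy hβ.le
  have h2 : Real.logb 2 (y / β) ≤ Real.logb 2 ((x + y + z) / β) := by
    refine Real.logb_le_logb_of_le one_lt_two (by positivity) ?_
    exact div_le_div_of_nonneg_right (by linarith) hβ.le
  have h3 : 0 ≤ Real.logb 2 ((x + y + z) / β) :=
    Real.logb_nonneg one_lt_two ((one_le_div hβ).mpr (by linarith))
  unfold entropy
  nlinarith [mul_le_mul_of_nonneg_left h1 hx0.le, mul_le_mul_of_nonneg_left h2 hy0.le,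
    mul_nonneg hz h3]

theorem le_mass_of_mem [Fintype E] (G : WGraph V E) {c : E → ℝ} (hc : ∀ e, 0 ≤ c e) {β : ℝ}
    (hβ : 0 < β) {X : Finset V} {v : V} (hv : v ∈ X) : β ≤ G.mass c β X := by
  have : (1 : ℝ) ≤ X.card := by exact_mod_cast Finset.card_pos.mpr ⟨v, hv⟩
  have : 0 ≤ ∑ e ∈ G.inside X, c e := Finset.sum_nonneg fun e _ => hc e
  unfold mass
  nlinarith

theorem mass_eq [Fintype E] (G : WGraph V E) (c : E → ℝ) (β : ℝ) {X P : Finset V} (hP : P ⊆ X) :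
    G.mass c β X =
      G.mass c β P + G.mass c β (X \ P) + ∑ e ∈ G.across P (X \ P), c e := by
  have hcard : (X.card : ℝ) = P.card + (X \ P).card := by
    exact_mod_cast (Finset.card_sdiff_add_card_eq_card hP).symm.trans (add_comm _ _)
  unfold mass
  rw [G.sum_inside_eq hP c, hcard]
  ring

theorem filter_cut_eq_across [Fintype E] (G : WGraph V E) (X : Finset V) (ψ : V → ℝ) (r : ℝ) :
    ({e ∈ G.inside X | min (ψ (G.ends e).1) (ψ (G.ends e).2) ≤ r ∧
      r < max (ψ (G.ends e).1) (ψ (G.ends e).2)} : Finset E) =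
    G.across {v ∈ X | ψ v ≤ r} (X \ {v ∈ X | ψ v ≤ r}) := by
  ext e
  simp only [Finset.mem_filter, mem_inside, mem_across, Finset.mem_sdiff, min_le_iff, lt_max_iff,
    not_and, not_le]
  constructor
  · rintro ⟨⟨h1, h2⟩, h3, h4⟩
    by_cases k1 : ψ (G.ends e).1 ≤ r <;> by_cases k2 : ψ (G.ends e).2 ≤ r <;> grind
  · grind

theorem mass_add_across_low [Fintype E] (G : WGraph V E) (c : E → ℝ) (β : ℝ) (X : Finset V)
    (ψ : V → ℝ) (r : ℝ) :
    G.mass c β {v ∈ X | ψ v ≤ r} +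
        ∑ e ∈ G.across {v ∈ X | ψ v ≤ r} (X \ {v ∈ X | ψ v ≤ r}), c e =
      β * ({v ∈ X | ψ v ≤ r} : Finset V).card +
        ∑ e ∈ G.inside X with min (ψ (G.ends e).1) (ψ (G.ends e).2) ≤ r, c e := by
  rw [mass, add_assoc, ← Finset.sum_union]
  · congr 2
    ext e
    simp only [Finset.mem_union, Finset.mem_filter, mem_inside, mem_across, Finset.mem_sdiff,
      min_le_iff]
    grind
  · rw [Finset.disjoint_left]
    simp only [mem_inside, mem_across, Finset.mem_sdiff]
    grind

theorem mass_add_across_high [Fintype E] (G : WGraph V E) (c : E → ℝ) (β : ℝ) (X : Finset V)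
    (ψ : V → ℝ) (r : ℝ) :
    G.mass c β (X \ {v ∈ X | ψ v ≤ r}) +
        ∑ e ∈ G.across {v ∈ X | ψ v ≤ r} (X \ {v ∈ X | ψ v ≤ r}), c e =
      β * (X \ {v ∈ X | ψ v ≤ r} : Finset V).card +
        ∑ e ∈ G.inside X with r < max (ψ (G.ends e).1) (ψ (G.ends e).2), c e := by
  rw [mass, add_assoc, ← Finset.sum_union]
  · congr 2
    ext e
    simp only [Finset.mem_union, Finset.mem_filter, mem_inside, mem_across, Finset.mem_sdiff,
      lt_max_iff, not_and, not_le]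
    constructor
    · grind
    · rintro ⟨⟨h1, h2⟩, h3⟩
      by_cases k1 : ψ (G.ends e).1 ≤ r <;> by_cases k2 : ψ (G.ends e).2 ≤ r <;> grind
  · rw [Finset.disjoint_left]
    simp only [mem_inside, mem_across, Finset.mem_sdiff]
    grind

/-- Region growing: some sublevel set of `ψ` has a boundary that is cheap compared to the
smaller of its two sides. -/
theorem exists_cheap_sublevel [Fintype E] (G : WGraph V E) {c : E → ℝ} (hc : ∀ e, 0 ≤ c e)
    {β : ℝ} (hβ : 0 < β) {X : Finset V} {N : ℕ} (hN : N ≠ 0) (hX : G.mass c β X ≤ 2 ^ N * β)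
    {ψ : V → ℝ}
    (hψ : ∀ e ∈ G.inside X, |ψ (G.ends e).1 - ψ (G.ends e).2| ≤ 8 * G.len e)
    {R : ℝ} (hR : 0 < R) {s x : V} (hsX : s ∈ X) (hs : ψ s ≤ 0) (hxX : x ∈ X) (hx : R < ψ x) :
    ∃ r, 0 ≤ r ∧ r ≤ R ∧
      (∑ e ∈ G.across {v ∈ X | ψ v ≤ r} (X \ {v ∈ X | ψ v ≤ r}), c e / G.len e) * R ≤
        32 * N * (entropy β (G.mass c β X) - entropy β (G.mass c β {v ∈ X | ψ v ≤ r}) -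
          entropy β (G.mass c β (X \ {v ∈ X | ψ v ≤ r}))) := by
  have hN0 : (0 : ℝ) < N := by exact_mod_cast Nat.pos_of_ne_zero hN
  let P : ℝ → Finset V := fun r => {v ∈ X | ψ v ≤ r}
  let z : ℝ → ℝ := fun r => ∑ e ∈ G.across (P r) (X \ P r), c e
  let a : E → ℝ := fun e => min (ψ (G.ends e).1) (ψ (G.ends e).2)
  let b : E → ℝ := fun e => max (ψ (G.ends e).1) (ψ (G.ends e).2)
  have hPX : ∀ r, P r ⊆ X := fun r => Finset.filter_subset _ _
  have hPmono : ∀ r t, r ≤ t → P r ⊆ P t := fun r t h =>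
    Finset.monotone_filter_right _ fun v _ hv => le_trans hv h
  have hsP : ∀ r, 0 ≤ r → s ∈ P r := fun r hr => Finset.mem_filter.mpr ⟨hsX, hs.trans hr⟩
  have hxP : ∀ r, r ≤ R → x ∈ X \ P r := fun r hr => by
    simp only [P, Finset.mem_sdiff, Finset.mem_filter, not_and, not_le]
    exact ⟨hxX, fun _ => hr.trans_lt hx⟩
  have hz : ∀ r, 0 ≤ z r := fun r => Finset.sum_nonneg fun e _ => hc e
  have hsplit : ∀ r, G.mass c β X = G.mass c β (P r) + G.mass c β (X \ P r) + z r :=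
    fun r => G.mass_eq c β (hPX r)
  have hmass : ∀ Y : Finset V, 0 ≤ G.mass c β Y := fun Y =>
    add_nonneg (by positivity) (Finset.sum_nonneg fun e _ => hc e)
  have hlow : ∀ r t, r ≤ t → G.mass c β (P r) + z r ≤ G.mass c β (P t) + z t := by
    intro r t h
    simp only [z, P, mass_add_across_low]
    gcongr
    exact fun e _ _ => hc e
  have hhigh : ∀ r t, r ≤ t →
      G.mass c β (X \ P t) + z t ≤ G.mass c β (X \ P r) + z r := by
    intro r t h
    simp only [z, P, mass_add_across_high]
    gcongr
    exact fun e _ _ => hc e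
  have hab : ∀ e ∈ G.inside X, b e - a e ≤ 8 * G.len e := by
    intro e he
    simp only [a, b, max_sub_min_eq_abs]
    rw [abs_sub_comm]
    exact hψ e he
  set h := R / (2 * N) with hh
  have hh0 : 0 < h := by positivity
  have hNh : N * h = R / 2 := by rw [hh]; field_simp
  have havg : ∀ p w,
      ∑ e ∈ G.inside X with a e < p + h ∧ p < b e, c e ≤ 2 * w →
      ∃ r ∈ Set.Ico p (p + h),
        (∑ e ∈ G.across (P r) (X \ P r), c e / G.len e) * R ≤ 32 * N * w := by
    intro p w hw
    obtain ⟨r, hr, hle⟩ := exists_sum_cut_le (G.inside X) a b c G.len G.len_pos hc hab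
      (by norm_num) (lt_add_of_pos_right p hh0)
    refine ⟨r, hr, ?_⟩
    rw [G.filter_cut_eq_across X ψ r, add_sub_cancel_left] at hle
    have hR' : R = 2 * N * h := by linarith
    calc _ = 2 * N * ((∑ e ∈ G.across (P r) (X \ P r), c e / G.len e) * h) := by
          rw [hR']; ring
      _ ≤ 2 * N * (8 * (2 * w)) :=
          mul_le_mul_of_nonneg_left (hle.trans (by linarith)) (by positivity)
      _ = 32 * N * w := by ring
  have hle1 : ∀ {j : ℕ}, j < N → (j : ℝ) + 1 ≤ N := fun hj => by exact_mod_cast hj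
  by_cases hhalf : 2 * G.mass c β (P (R / 2)) ≤ G.mass c β X
  · obtain ⟨j, hj, hdouble⟩ := exists_succ_le_two_mul (β := β)
      (u := fun j => G.mass c β (P (j * h)) + z (j * h)) hN
      (by
        have := G.le_mass_of_mem hc hβ (hsP (((0 : ℕ) : ℝ) * h) (by simp))
        have := hz (((0 : ℕ) : ℝ) * h)
        linarith)
      (by
        have := hsplit (N * h)
        have := hmass (X \ P (N * h))
        linarith)
    have hjh : (((j + 1 : ℕ) : ℝ)) * h = j * h + h := by push_cast; ring
    simp only [hjh] at hdouble
    obtain ⟨r, hr, hle⟩ := havg (j * h) (G.mass c β (P (j * h)) + z (j * h)) (by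
      refine le_trans ?_ hdouble
      simp only [z, P, mass_add_across_low]
      refine le_trans ?_ (le_add_of_nonneg_left (by positivity))
      refine Finset.sum_le_sum_of_subset_of_nonneg ?_ fun e _ _ => hc e
      exact Finset.monotone_filter_right _ fun e _ he => he.1.le)
    have hr0 : 0 ≤ r := le_trans (by positivity) hr.1
    have hrR : r ≤ R / 2 := by nlinarith [hr.2, hle1 hj]
    refine ⟨r, hr0, by linarith, hle.trans ?_⟩
    refine mul_le_mul_of_nonneg_left ?_ (by positivity)
    refine (hlow _ _ hr.1).trans ?_
    rw [hsplit r]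
    refine add_le_entropy_sub hβ (G.le_mass_of_mem hc hβ (hsP r hr0))
      (G.le_mass_of_mem hc hβ (hxP r (by linarith))) (hz r) ?_
    rw [← hsplit r]
    refine le_trans ?_ hhalf
    have hsub := hPmono _ _ hrR
    have := G.mass_eq c β hsub
    have := hmass (P (R / 2) \ P r)
    have : 0 ≤ ∑ e ∈ G.across (P r) (P (R / 2) \ P r), c e := Finset.sum_nonneg fun e _ => hc e
    linarith
  · obtain ⟨j, hj, hdouble⟩ := exists_succ_le_two_mul (β := β)
      (u := fun j => G.mass c β (X \ P (R - j * h)) + z (R - j * h)) hN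
      (by
        have := G.le_mass_of_mem hc hβ (hxP (R - ((0 : ℕ) : ℝ) * h) (by simp))
        have := hz (R - ((0 : ℕ) : ℝ) * h)
        linarith)
      (by
        have := hsplit (R - N * h)
        have := hmass (P (R - N * h))
        linarith)
    have hjh : R - (((j + 1 : ℕ) : ℝ)) * h = R - j * h - h := by push_cast; ring
    simp only [hjh] at hdouble
    obtain ⟨r, hr, hle⟩ := havg (R - j * h - h)
      (G.mass c β (X \ P (R - j * h)) + z (R - j * h)) (by
      refine le_trans ?_ hdouble
      simp only [z, P, mass_add_across_high]
      refine le_trans ?_ (le_add_of_nonneg_left (by positivity))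
      refine Finset.sum_le_sum_of_subset_of_nonneg ?_ fun e _ _ => hc e
      exact Finset.monotone_filter_right _ fun e _ he => he.2)
    have hrR : R / 2 ≤ r := by nlinarith [hr.1, hle1 hj]
    have hr2 : r ≤ R - j * h := by linarith [hr.2]
    have hrR' : r ≤ R := hr2.trans (sub_le_self _ (by positivity))
    refine ⟨r, by linarith, hrR', hle.trans ?_⟩
    refine mul_le_mul_of_nonneg_left ?_ (by positivity)
    refine (hhigh _ _ hr2).trans ?_
    rw [hsplit r, sub_right_comm, add_comm (G.mass c β (P r))]
    refine add_le_entropy_sub hβ (G.le_mass_of_mem hc hβ (hxP r hrR'))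
      (G.le_mass_of_mem hc hβ (hsP r (by linarith))) (hz r) ?_
    have hsub := hPmono _ _ hrR
    have := G.mass_eq c β hsub
    have := hmass (P r \ P (R / 2))
    have : 0 ≤ ∑ e ∈ G.across (P (R / 2)) (P r \ P (R / 2)), c e :=
      Finset.sum_nonneg fun e _ => hc e
    have := hsplit r
    have := hz r
    linarith

/-- Edge lengths in which the edges outside the highway `A` count twice. -/
noncomputable def hlen (G : WGraph V E) (A : Finset V) (e : E) : ℝ :=
  if (G.ends e).1 ∈ A ∧ (G.ends e).2 ∈ A then G.len e else 2 * G.len e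

theorem len_le_hlen (G : WGraph V E) (A : Finset V) (e : E) : G.len e ≤ G.hlen A e := by
  have := G.len_pos e
  unfold hlen
  split_ifs <;> linarith

theorem hlen_le_two_mul (G : WGraph V E) (A : Finset V) (e : E) : G.hlen A e ≤ 2 * G.len e := by
  have := G.len_pos e
  unfold hlen
  split_ifs <;> linarith

theorem hlen_pos (G : WGraph V E) (A : Finset V) (e : E) : 0 < G.hlen A e :=
  (G.len_pos e).trans_le (G.len_le_hlen A e)

theorem Joins.hlen_eq {G : WGraph V E} {e : E} {u v : V} (h : G.Joins e u v) (A : Finset V) :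
    G.hlen A e = if u ∈ A ∧ v ∈ A then G.len e else 2 * G.len e := by
  rcases h with h | h <;> simp [hlen, h, and_comm]

/-- `B` is the vertex set of a path from `x0` along which `f` increases by the lengths `k`. -/
structure IsHighway (G : WGraph V E) (k : E → ℝ) (f : V → ℝ) (B : Finset V) (x0 : V) : Prop where
  root : x0 ∈ B
  step : ∀ a ∈ B, a ≠ x0 → ∃ e b, b ∈ B ∧ G.Joins e b a ∧ f a = f b + k e ∧
    ∀ c ∈ B, c ≠ a → f c ≤ f a → f c ≤ f b

/-- `f` is the distance from `x0` inside `X` for the lengths `G.hlen A`, and the highway `A` is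
the vertex set of a shortest path from `x0`. -/
structure Rooted (G : WGraph V E) (X A : Finset V) (x0 : V) (f : V → ℝ) : Prop where
  sub : A ⊆ X
  zero : f x0 = 0
  lip : ∀ e u v, G.Joins e u v → u ∈ X → v ∈ X → f v ≤ f u + G.hlen A e
  parent : ∀ v ∈ X, v ≠ x0 → ∃ e u, u ∈ X ∧ G.Joins e u v ∧ f v = f u + G.hlen A e
  highway : G.IsHighway (G.hlen A) f A x0

namespace Rooted

variable {G : WGraph V E} {X A : Finset V} {x0 : V} {f : V → ℝ}

theorem root_mem (h : G.Rooted X A x0 f) : x0 ∈ X := h.sub h.highway.root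

theorem nonneg (h : G.Rooted X A x0 f) : ∀ v ∈ X, 0 ≤ f v := by
  refine descent_induction (x := x0) (f := f) h.zero.ge fun v hv hne => ?_
  obtain ⟨e, u, hu, -, hf⟩ := h.parent v hv hne
  have := G.hlen_pos A e
  exact ⟨u, hu, by linarith, fun _ => by linarith⟩

theorem pos (h : G.Rooted X A x0 f) {v : V} (hv : v ∈ X) (hne : v ≠ x0) : 0 < f v := by
  obtain ⟨e, u, hu, -, hf⟩ := h.parent v hv hne
  have := G.hlen_pos A e
  have := h.nonneg u hu
  linarith

theorem exists_highway (h : G.Rooted X A x0 f) :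
    ∀ v ∈ X, ∃ B ⊆ X, v ∈ B ∧ (∀ b ∈ B, f b ≤ f v) ∧ G.IsHighway (G.hlen A) f B x0 := by
  refine descent_induction (x := x0) (f := f) ⟨{x0}, ?_, ?_, ?_, ?_, ?_⟩ fun v hv hne => ?_
  · simpa using h.root_mem
  · simp
  · simp
  · simp
  · simp
  · obtain ⟨e, u, hu, he, hf⟩ := h.parent v hv hne
    have := G.hlen_pos A e
    refine ⟨u, hu, by linarith, ?_⟩
    rintro ⟨B, hBX, huB, hBu, hB⟩
    refine ⟨insert v B, Finset.insert_subset hv hBX, by simp, ?_, by simp [hB.root], ?_⟩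
    · intro b hb
      rcases Finset.mem_insert.mp hb with rfl | hb
      · exact le_rfl
      · have := hBu b hb
        linarith
    · intro a ha hax
      rcases Finset.mem_insert.mp ha with rfl | haB
      · refine ⟨e, u, by simp [huB], he, hf, fun c hc hca _ => ?_⟩
        exact hBu c ((Finset.mem_insert.mp hc).resolve_left hca)
      · obtain ⟨e', b, hb, he', hf', hmax⟩ := hB.step a haB hax
        refine ⟨e', b, by simp [hb], he', hf', fun c hc hca hfc => ?_⟩
        rcases Finset.mem_insert.mp hc with rfl | hc
        · have := hBu a haB
          linarith
        · exact hmax c hc hca hfc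

end Rooted

/-- Costs of paths that leave the highway `B` at a vertex `b`, at a cost of `f s - f b`, and then
pay twice the excess of the traversed length over the increase of `f`. -/
def PetalReach (G : WGraph V E) (X A B : Finset V) (f : V → ℝ) (s : V) : V → ℝ → Prop :=
  CostReach (fun v L => v ∈ B ∧ L = f s - f v)
    (G.edgeArc X fun e u v => 2 * (G.hlen A e + f u - f v))

/-- `ψ` is the least cost for `PetalReach`. -/
def IsPetalPotential (G : WGraph V E) (X A B : Finset V) (f : V → ℝ) (s : V) (ψ : V → ℝ) : Prop :=
  ∀ v ∈ X, G.PetalReach X A B f s v (ψ v) ∧ ∀ L, G.PetalReach X A B f s v L → ψ v ≤ L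

section Petal

variable {G : WGraph V E} {X A B : Finset V} {x0 s : V} {f ψ : V → ℝ}

theorem Rooted.exists_petalPotential [Fintype V] [Fintype E] (h : G.Rooted X A x0 f)
    (hroot : x0 ∈ B) (hBs : ∀ b ∈ B, f b ≤ f s) :
    ∃ ψ, G.IsPetalPotential X A B f s ψ := by
  refine CostReach.exists_potential ?_ (G.finite_edgeArc X _) ?_ ?_ X ?_
  · refine (Set.finite_range fun v => f s - f v).subset ?_
    rintro L ⟨v, -, rfl⟩
    exact ⟨v, rfl⟩
  · rintro v L ⟨hv, rfl⟩
    exact sub_nonneg.mpr (hBs v hv)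
  · rintro u v k ⟨e, he, hu, hv, rfl⟩
    have := h.lip e u v he hu hv
    linarith
  · refine descent_induction (x := x0) (f := f) ⟨_, .src ⟨hroot, rfl⟩⟩ fun v hv hne => ?_
    obtain ⟨e, u, hu, he, hf⟩ := h.parent v hv hne
    have := G.hlen_pos A e
    refine ⟨u, hu, by linarith, ?_⟩
    rintro ⟨L, hL⟩
    exact ⟨_, hL.step ⟨e, he, hu, hv, rfl⟩⟩

theorem IsPetalPotential.le_add (hψ : G.IsPetalPotential X A B f s ψ) {e : E} {u v : V}
    (he : G.Joins e u v) (hu : u ∈ X) (hv : v ∈ X) :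
    ψ v ≤ ψ u + 2 * (G.hlen A e + f u - f v) :=
  (hψ v hv).2 _ ((hψ u hu).1.step ⟨e, he, hu, hv, rfl⟩)

theorem IsPetalPotential.le_of_mem (hψ : G.IsPetalPotential X A B f s ψ) {b : V} (hb : b ∈ B)
    (hbX : b ∈ X) : ψ b ≤ f s - f b :=
  (hψ b hbX).2 _ (.src ⟨hb, rfl⟩)

theorem IsPetalPotential.sub_le (hψ : G.IsPetalPotential X A B f s ψ) (h : G.Rooted X A x0 f)
    {v : V} (hv : v ∈ X) : f s - f v ≤ ψ v := by
  have key : ∀ v L, G.PetalReach X A B f s v L → f s - f v ≤ L := by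
    intro v L hL
    induction hL with
    | src h' => exact h'.2.ge
    | step h1 h2 ih =>
      obtain ⟨e, he, hu, hv, rfl⟩ := h2
      have := h.lip e _ _ he hu hv
      have := G.hlen_pos A e
      linarith
  exact key v _ (hψ v hv).1

theorem IsPetalPotential.abs_sub_le [Fintype E] (hψ : G.IsPetalPotential X A B f s ψ)
    (h : G.Rooted X A x0 f) {e : E} (he : e ∈ G.inside X) :
    |ψ (G.ends e).1 - ψ (G.ends e).2| ≤ 8 * G.len e := by
  obtain ⟨h1, h2⟩ := mem_inside.mp he
  have hJ := G.joins_ends e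
  have := hψ.le_add hJ h1 h2
  have := hψ.le_add hJ.symm h2 h1
  have := h.lip e _ _ hJ h1 h2
  have := h.lip e _ _ hJ.symm h2 h1
  have := G.hlen_le_two_mul A e
  rw [abs_sub_le_iff]
  constructor <;> linarith

/-- The graph that remains after the removal of a petal. -/
theorem IsPetalPotential.rooted_sdiff (hψ : G.IsPetalPotential X A B f s ψ)
    (h : G.Rooted X A x0 f) {r : ℝ} (hx0 : r < ψ x0) :
    G.Rooted (X \ {v ∈ X | ψ v ≤ r}) (A \ {v ∈ X | ψ v ≤ r}) x0 f := by
  have hmem : ∀ {v}, v ∈ X \ ({v ∈ X | ψ v ≤ r} : Finset V) ↔ v ∈ X ∧ r < ψ v := by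
    intro v
    simp only [Finset.mem_sdiff, Finset.mem_filter, not_and, not_le]
    tauto
  have hmemA : ∀ {v}, v ∈ A \ ({v ∈ X | ψ v ≤ r} : Finset V) ↔ v ∈ A ∧ r < ψ v := by
    intro v
    have := @h.sub v
    simp only [Finset.mem_sdiff, Finset.mem_filter, not_and, not_le]
    tauto
  have hlen_eq : ∀ {e u v}, G.Joins e u v → r < ψ u → r < ψ v →
      G.hlen (A \ ({v ∈ X | ψ v ≤ r} : Finset V)) e = G.hlen A e := by
    intro e u v he hu hv
    rw [he.hlen_eq, he.hlen_eq]
    simp only [hmemA, hu, hv, and_true]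
  have htight : ∀ {e u v}, G.Joins e u v → u ∈ X → v ∈ X → f v = f u + G.hlen A e → r < ψ v →
      r < ψ u := by
    intro e u v he hu hv hf hr
    have := hψ.le_add he hu hv
    linarith
  refine ⟨Finset.sdiff_subset_sdiff h.sub le_rfl, h.zero, ?_, ?_, ?_, ?_⟩
  · intro e u v he hu hv
    rw [hmem] at hu hv
    rw [hlen_eq he hu.2 hv.2]
    exact h.lip e u v he hu.1 hv.1
  · intro v hv hne
    rw [hmem] at hv
    obtain ⟨e, u, hu, he, hf⟩ := h.parent v hv.1 hne
    have hru := htight he hu hv.1 hf hv.2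
    exact ⟨e, u, hmem.mpr ⟨hu, hru⟩, he, by rw [hlen_eq he hru hv.2, hf]⟩
  · exact hmemA.mpr ⟨h.highway.root, hx0⟩
  · intro a ha hne
    rw [hmemA] at ha
    obtain ⟨e, b, hb, he, hf, hmax⟩ := h.highway.step a ha.1 hne
    have hrb := htight he (h.sub hb) (h.sub ha.1) hf ha.2
    refine ⟨e, b, hmemA.mpr ⟨hb, hrb⟩, he, by rw [hlen_eq he hrb ha.2, hf], fun c hc => ?_⟩
    exact hmax c (hmemA.mp hc).1

/-- A petal, with the lowest vertex `x` of the highway `B` inside it as its root. -/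
theorem IsPetalPotential.exists_rooted [Fintype V] [Fintype E]
    (hψ : G.IsPetalPotential X A B f s ψ)
    (h : G.Rooted X A x0 f) (hBX : B ⊆ X) (hB : G.IsHighway (G.hlen A) f B x0) {r : ℝ}
    {P : Finset V} (hP : P = {v ∈ X | ψ v ≤ r}) {x : V} (hxB : x ∈ B ∩ P)
    (hxmin : ∀ b ∈ B ∩ P, f x ≤ f b) (hx0P : x0 ∉ P) {μ κ : ℝ} (hμ : 0 < μ)
    (hlow : ∀ e ∈ G.inside P, μ * G.hlen A e ≤ G.hlen (B ∩ P) e)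
    (heq : ∀ e ∈ G.inside (B ∩ P), G.hlen (B ∩ P) e = μ * G.hlen A e)
    (hup : ∀ e ∈ G.inside P, G.hlen (B ∩ P) e ≤ G.hlen A e)
    (hκ : ∀ p ∈ B ∩ P, μ * (f p - f x) ≤ f p + (f s - f p) / 2 + κ) :
    ∃ f', G.Rooted P (B ∩ P) x f' ∧ (∀ a ∈ B ∩ P, f' a = μ * (f a - f x)) ∧
      ∀ v ∈ P, f' v ≤ f v + ψ v / 2 + κ := by
  have hmem : ∀ {v}, v ∈ P ↔ v ∈ X ∧ ψ v ≤ r := by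
    intro v
    rw [hP, Finset.mem_filter]
  have hxP : x ∈ P := (Finset.mem_inter.mp hxB).2
  have hxr : f s - r ≤ f x := by
    have := hψ.sub_le h (hmem.mp hxP).1
    have := (hmem.mp hxP).2
    linarith
  let src : V → ℝ → Prop := fun v L => v = x ∧ L = 0
  let arc : V → V → ℝ → Prop := G.edgeArc P fun e _ _ => G.hlen (B ∩ P) e
  have hprev : ∀ a ∈ B ∩ P, a ≠ x → ∃ e b, b ∈ B ∩ P ∧ G.Joins e b a ∧
      f a = f b + G.hlen A e ∧ ∀ c ∈ B, c ≠ a → f c ≤ f a → f c ≤ f b := by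
    intro a ha hne
    obtain ⟨haB, haP⟩ := Finset.mem_inter.mp ha
    obtain ⟨e, b, hb, he, hf, hmax⟩ := hB.step a haB (by rintro rfl; exact hx0P haP)
    have hxb := hmax x (Finset.mem_inter.mp hxB).1 hne.symm (hxmin a ha)
    have hψb := hψ.le_of_mem hb (hBX hb)
    exact ⟨e, b, Finset.mem_inter.mpr ⟨hb, hmem.mpr ⟨hBX hb, by linarith⟩⟩, he, hf, hmax⟩
  have hreachB : ∀ a ∈ B ∩ P, CostReach src arc a (μ * (f a - f x)) := by
    refine descent_induction (x := x) (f := f) (.src ⟨rfl, by simp⟩) fun a ha hne => ?_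
    obtain ⟨e, b, hb, he, hf, -⟩ := hprev a ha hne
    have := G.hlen_pos A e
    refine ⟨b, hb, by linarith, fun hr => ?_⟩
    have hval : μ * (f a - f x) = μ * (f b - f x) + G.hlen (B ∩ P) e := by
      rw [heq e (he.mem_inside hb ha), hf]
      ring
    rw [hval]
    exact hr.step ⟨e, he, (Finset.mem_inter.mp hb).2, (Finset.mem_inter.mp ha).2, rfl⟩
  have hreach : ∀ v L, G.PetalReach X A B f s v L → v ∈ X → L ≤ r →
      ∃ L' ≤ f v + L / 2 + κ, CostReach src arc v L' := by
    intro v L hL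
    induction hL with
    | src h' =>
      obtain ⟨hvB, rfl⟩ := h'
      intro hvX hLr
      have hvP := Finset.mem_inter.mpr
        ⟨hvB, hmem.mpr ⟨hvX, (hψ.le_of_mem hvB hvX).trans hLr⟩⟩
      exact ⟨_, hκ _ hvP, hreachB _ hvP⟩
    | step h1 h2 ih =>
      obtain ⟨e, he, hu, hv, rfl⟩ := h2
      intro _ hLr
      have hlip := h.lip e _ _ he hu hv
      obtain ⟨L', hL', hr⟩ := ih hu (by linarith)
      have huP := hmem.mpr ⟨hu, ((hψ _ hu).2 _ h1).trans (by linarith)⟩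
      have hvP := hmem.mpr ⟨hv, ((hψ _ hv).2 _ (h1.step ⟨e, he, hu, hv, rfl⟩)).trans hLr⟩
      refine ⟨_, ?_, hr.step ⟨e, he, huP, hvP, rfl⟩⟩
      have := hup e (he.mem_inside huP hvP)
      linarith
  have hreachP : ∀ v ∈ P, ∃ L' ≤ f v + ψ v / 2 + κ, CostReach src arc v L' := fun v hv =>
    hreach v _ (hψ v (hmem.mp hv).1).1 (hmem.mp hv).1 (hmem.mp hv).2
  obtain ⟨f', hf'⟩ := CostReach.exists_potential (src := src) (arc := arc)
    ((Set.finite_singleton (0 : ℝ)).subset (by rintro L ⟨v, -, rfl⟩; rfl))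
    (G.finite_edgeArc P _) (by rintro v L ⟨-, rfl⟩; exact le_rfl)
    (by rintro u v k ⟨e, -, -, -, rfl⟩; exact (G.hlen_pos _ e).le) P
    (fun v hv => (hreachP v hv).imp fun _ h => h.2)
  have hlower : ∀ v L, CostReach src arc v L → μ * (f v - f x) ≤ L := by
    intro v L hL
    induction hL with
    | src h' =>
      obtain ⟨rfl, rfl⟩ := h'
      simp
    | step h1 h2 ih =>
      obtain ⟨e, he, hu, hv, rfl⟩ := h2
      have h3 := h.lip e _ _ he (hmem.mp hu).1 (hmem.mp hv).1
      have h4 := hlow e (he.mem_inside hu hv)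
      nlinarith [mul_le_mul_of_nonneg_left h3 hμ.le]
  have hexact : ∀ a ∈ B ∩ P, f' a = μ * (f a - f x) := fun a ha =>
    le_antisymm ((hf' a (Finset.mem_inter.mp ha).2).2 _ (hreachB a ha))
      (hlower a _ (hf' a (Finset.mem_inter.mp ha).2).1)
  refine ⟨f', ⟨Finset.inter_subset_right, ?_, ?_, ?_, hxB, ?_⟩, hexact, ?_⟩
  · rw [hexact x hxB, sub_self, mul_zero]
  · intro e u v he hu hv
    exact (hf' v hv).2 _ ((hf' u hu).1.step ⟨e, he, hu, hv, rfl⟩)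
  · intro v hv hne
    have hmin := (hf' v hv).2
    obtain h1 | ⟨h1, h2⟩ : src v (f' v) ∨ ∃ u L k, CostReach src arc u L ∧ arc u v k ∧
        f' v = L + k := by
      have hv' := (hf' v hv).1
      generalize f' v = y at hv'
      cases hv' with
      | src h => exact Or.inl h
      | step h h' => exact Or.inr ⟨_, _, _, h, h', rfl⟩
    · exact absurd h1.1 hne
    · obtain ⟨L, k, hL, ⟨e, he, hu, -, rfl⟩, hval⟩ := h2
      refine ⟨e, h1, hu, he, ?_⟩
      have h3 := (hf' h1 hu).2 L hL
      have h4 := hmin _ ((hf' h1 hu).1.step ⟨e, he, hu, hv, rfl⟩)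
      linarith
  · intro a ha hne
    obtain ⟨e, b, hb, he, hf, hmax⟩ := hprev a ha hne
    refine ⟨e, b, hb, he, ?_, fun c hc hca hfc => ?_⟩
    · rw [hexact a ha, hexact b hb, heq e (he.mem_inside hb ha), hf]
      ring
    · rw [hexact c hc, hexact a ha, mul_le_mul_iff_right₀ hμ] at hfc
      rw [hexact c hc, hexact b hb, mul_le_mul_iff_right₀ hμ]
      have := hmax c (Finset.mem_inter.mp hc).1 hca (by linarith)
      linarith
  · intro v hv
    obtain ⟨L', hL', hr⟩ := hreachP v hv
    exact ((hf' v hv).2 _ hr).trans hL'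

end Petal

/-- Some spanning tree of `X` approximately preserves the distances `f` from `x0` to the vertices
of `X`, exactly preserves the distances from `x0` to the highway `A`, and has small total
`c`-weighted stretch. -/
def HasTree [Fintype E] (G : WGraph V E) (c : E → ℝ) (β K : ℝ) (X A : Finset V) (x0 : V)
    (f : V → ℝ) : Prop :=
  ∃ (T : Finset E) (D : E → ℝ), T ⊆ G.inside X ∧ T.card + 1 = X.card ∧
    (∀ v ∈ X, G.JoinedIn T x0 v (2 * f v)) ∧ (∀ a ∈ A, G.JoinedIn T x0 a (f a)) ∧
    (∀ e ∈ G.inside X, G.JoinedIn T (G.ends e).1 (G.ends e).2 (D e)) ∧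
    ∑ e ∈ G.inside X, c e * D e / G.len e ≤ K * entropy β (G.mass c β X)

theorem HasTree.glue [Fintype E] {G : WGraph V E} {c : E → ℝ} {β K : ℝ} {X A P A' : Finset V}
    {x0 x y : V} {f f' : V → ℝ} (hPX : P ⊆ X)
    (hQ : G.HasTree c β K (X \ P) (A \ P) x0 f) (hP : G.HasTree c β K P A' x f') {b : E}
    {Dy Δ : ℝ} (hb : G.Joins b y x) (hy : y ∈ X \ P) (hx : x ∈ P)
    (hDy : y ∈ A \ P ∧ Dy = f y ∨ Dy = 2 * f y)
    (hfP : ∀ v ∈ P, Dy + G.len b + 2 * f' v ≤ 2 * f v)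
    (hfA : ∀ a ∈ A, a ∈ P → a ∈ A' ∧ Dy + G.len b + f' a ≤ f a) (hΔ : ∀ v ∈ X, f v ≤ Δ)
    (hcost : (∑ e ∈ G.across P (X \ P), c e / G.len e) * (4 * Δ) ≤
      K * (entropy β (G.mass c β X) - entropy β (G.mass c β P) -
        entropy β (G.mass c β (X \ P)))) :
    G.HasTree c β K X A x0 f := by
  obtain ⟨TQ, DQ, hTQ, hcardQ, hvQ, haQ, heQ, hsQ⟩ := hQ
  obtain ⟨TP, DP, hTP, hcardP, hvP, haP, heP, hsP⟩ := hP
  have hyP := (Finset.mem_sdiff.mp hy).2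
  have hyX := (Finset.mem_sdiff.mp hy).1
  have hdisj : Disjoint TQ TP := by
    rw [Finset.disjoint_left]
    intro e h1 h2
    exact (Finset.mem_sdiff.mp (mem_inside.mp (hTQ h1)).1).2 (mem_inside.mp (hTP h2)).1
  have hbTQ : b ∉ TQ := by
    intro h
    obtain ⟨h1, h2⟩ := mem_inside.mp (hTQ h)
    rcases hb with hb | hb <;> rw [hb] at h1 h2
    exacts [(Finset.mem_sdiff.mp h2).2 hx, (Finset.mem_sdiff.mp h1).2 hx]
  have hbTP : b ∉ TP := by
    intro h
    obtain ⟨h1, h2⟩ := mem_inside.mp (hTP h)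
    rcases hb with hb | hb <;> rw [hb] at h1 h2
    exacts [hyP h1, hyP h2]
  set T := insert b (TQ ∪ TP) with hT
  have hsubQ : TQ ⊆ T := Finset.subset_union_left.trans (Finset.subset_insert _ _)
  have hsubP : TP ⊆ T := Finset.subset_union_right.trans (Finset.subset_insert _ _)
  have hjoin : ∀ {v L}, G.JoinedIn TP x v L → G.JoinedIn T x0 v (Dy + G.len b + L) := by
    intro v L h
    have h0 : G.JoinedIn TQ x0 y Dy := by
      rcases hDy with ⟨hyA, rfl⟩ | rfl
      exacts [haQ y hyA, hvQ y hy]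
    exact ((h0.mono hsubQ).trans (.of_mem (Finset.mem_insert_self _ _) hb)).trans (h.mono hsubP)
  have hv : ∀ v ∈ X, G.JoinedIn T x0 v (2 * f v) := by
    intro v hv
    by_cases hvp : v ∈ P
    · exact (hjoin (hvP v hvp)).le (hfP v hvp)
    · exact (hvQ v (Finset.mem_sdiff.mpr ⟨hv, hvp⟩)).mono hsubQ
  refine ⟨T, fun e => if e ∈ G.inside P then DP e else if e ∈ G.inside (X \ P) then DQ e
    else 4 * Δ, ?_, ?_, hv, ?_, ?_, ?_⟩
  · refine Finset.insert_subset (hb.mem_inside hyX (hPX hx)) (Finset.union_subset ?_ ?_)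
    · intro e he
      obtain ⟨h1, h2⟩ := mem_inside.mp (hTQ he)
      exact mem_inside.mpr ⟨(Finset.mem_sdiff.mp h1).1, (Finset.mem_sdiff.mp h2).1⟩
    · intro e he
      obtain ⟨h1, h2⟩ := mem_inside.mp (hTP he)
      exact mem_inside.mpr ⟨hPX h1, hPX h2⟩
  · rw [hT, Finset.card_insert_of_notMem (by simp [hbTQ, hbTP]),
      Finset.card_union_of_disjoint hdisj]
    have := Finset.card_sdiff_add_card_eq_card hPX
    omega
  · intro a ha
    by_cases hap : a ∈ P
    · obtain ⟨h1, h2⟩ := hfA a ha hap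
      exact (hjoin (haP a h1)).le h2
    · exact (haQ a (Finset.mem_sdiff.mpr ⟨ha, hap⟩)).mono hsubQ
  · intro e he
    dsimp only
    split_ifs with h1 h2
    · exact (heP e h1).mono hsubP
    · exact (heQ e h2).mono hsubQ
    · obtain ⟨h3, h4⟩ := mem_inside.mp he
      refine ((hv _ h3).symm.trans (hv _ h4)).le ?_
      linarith [hΔ _ h3, hΔ _ h4]
  · have hdisjQ : ∀ e ∈ G.inside (X \ P), e ∉ G.inside P := fun e h1 h2 =>
      (Finset.mem_sdiff.mp (mem_inside.mp h1).1).2 (mem_inside.mp h2).1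
    rw [G.sum_inside_eq hPX]
    have e1 : ∑ e ∈ G.inside P, c e * (if e ∈ G.inside P then DP e else
        if e ∈ G.inside (X \ P) then DQ e else 4 * Δ) / G.len e =
        ∑ e ∈ G.inside P, c e * DP e / G.len e :=
      Finset.sum_congr rfl fun e he => by rw [if_pos he]
    have e2 : ∑ e ∈ G.inside (X \ P), c e * (if e ∈ G.inside P then DP e else
        if e ∈ G.inside (X \ P) then DQ e else 4 * Δ) / G.len e =
        ∑ e ∈ G.inside (X \ P), c e * DQ e / G.len e :=
      Finset.sum_congr rfl fun e he => by rw [if_neg (hdisjQ e he), if_pos he]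
    have e3 : ∑ e ∈ G.across P (X \ P), c e * (if e ∈ G.inside P then DP e else
        if e ∈ G.inside (X \ P) then DQ e else 4 * Δ) / G.len e =
        (∑ e ∈ G.across P (X \ P), c e / G.len e) * (4 * Δ) := by
      rw [Finset.sum_mul]
      refine Finset.sum_congr rfl fun e he => ?_
      rw [mem_across] at he
      have h1 : e ∉ G.inside P := by
        rw [mem_inside]
        rintro ⟨h1, h2⟩
        rcases he with he | he
        exacts [(Finset.mem_sdiff.mp he.2).2 h2, (Finset.mem_sdiff.mp he.1).2 h1]
      have h2 : e ∉ G.inside (X \ P) := by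
        rw [mem_inside]
        rintro ⟨h1, h2⟩
        rcases he with he | he
        exacts [(Finset.mem_sdiff.mp h1).2 he.1, (Finset.mem_sdiff.mp h2).2 he.2]
      rw [if_neg h1, if_neg h2]
      ring
    rw [e1, e2, e3]
    linarith

theorem mass_le_of_subset [Fintype E] (G : WGraph V E) {c : E → ℝ} (hc : ∀ e, 0 ≤ c e) {β : ℝ}
    (hβ : 0 < β) {X P : Finset V} (hP : P ⊆ X) : G.mass c β P ≤ G.mass c β X := by
  refine add_le_add (mul_le_mul_of_nonneg_left (by exact_mod_cast Finset.card_le_card hP) hβ.le)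
    (Finset.sum_le_sum_of_subset_of_nonneg (fun e he => ?_) fun e _ _ => hc e)
  obtain ⟨h1, h2⟩ := mem_inside.mp he
  exact mem_inside.mpr ⟨hP h1, hP h2⟩

/-- A petal around the end `s` of the highway `B`, together with the edge `b` of `B` that enters
it, such that few edges leave the petal. -/
theorem Rooted.exists_petal [Fintype V] [Fintype E] {G : WGraph V E} {X A B : Finset V}
    {x0 s : V} {f : V → ℝ} (h : G.Rooted X A x0 f) {c : E → ℝ} (hc : ∀ e, 0 ≤ c e) {β : ℝ}
    (hβ : 0 < β) {N : ℕ} (hN : N ≠ 0) (hX : G.mass c β X ≤ 2 ^ N * β) (hBX : B ⊆ X)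
    (hB : G.IsHighway (G.hlen A) f B x0) (hs : s ∈ B) (hBs : ∀ b ∈ B, f b ≤ f s) {R : ℝ}
    (hR : 0 < R) (hRs : R < f s) :
    ∃ (ψ : V → ℝ) (r : ℝ) (P : Finset V) (x y : V) (b : E),
      G.IsPetalPotential X A B f s ψ ∧ r ≤ R ∧ P = {v ∈ X | ψ v ≤ r} ∧ x0 ∉ P ∧
      x ∈ B ∩ P ∧ (∀ p ∈ B ∩ P, f x ≤ f p) ∧ y ∈ B ∧ y ∉ P ∧ G.Joins b y x ∧
      f x = f y + G.hlen A b ∧ f y < f s - r ∧ (∀ v ∈ P, f s - r ≤ f v) ∧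
      G.Rooted (X \ P) (A \ P) x0 f ∧
      (∑ e ∈ G.across P (X \ P), c e / G.len e) * R ≤
        32 * N * (entropy β (G.mass c β X) - entropy β (G.mass c β P) -
          entropy β (G.mass c β (X \ P))) := by
  obtain ⟨ψ, hψ⟩ := h.exists_petalPotential hB.root hBs
  have hψs : ψ s ≤ 0 := by simpa using hψ.le_of_mem hs (hBX hs)
  have hψ0 : f s ≤ ψ x0 := by simpa [h.zero] using hψ.sub_le h h.root_mem
  obtain ⟨r, hr0, hrR, hcost⟩ := G.exists_cheap_sublevel hc hβ hN hX
    (fun e he => hψ.abs_sub_le h he) hR (hBX hs) hψs h.root_mem (hRs.trans_le hψ0)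
  have hQ := hψ.rooted_sdiff h (hrR.trans_lt (hRs.trans_le hψ0))
  obtain ⟨P, hP⟩ : ∃ P : Finset V, P = {v ∈ X | ψ v ≤ r} := ⟨_, rfl⟩
  rw [← hP] at hcost hQ
  have hmem : ∀ {v}, v ∈ P ↔ v ∈ X ∧ ψ v ≤ r := by
    intro v
    rw [hP, Finset.mem_filter]
  have hx0P : x0 ∉ P := fun hx => by
    have := (hmem.mp hx).2
    linarith
  obtain ⟨x, hx, hxmin⟩ := (B ∩ P).exists_min_image f
    ⟨s, Finset.mem_inter.mpr ⟨hs, hmem.mpr ⟨hBX hs, hψs.trans hr0⟩⟩⟩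
  obtain ⟨hxB, hxP⟩ := Finset.mem_inter.mp hx
  obtain ⟨b, y, hy, hb, hf, -⟩ := hB.step x hxB (by rintro rfl; exact hx0P hxP)
  have hyP : y ∉ P := fun hyP => by
    have := hxmin y (Finset.mem_inter.mpr ⟨hy, hyP⟩)
    have := G.hlen_pos A b
    linarith
  refine ⟨ψ, r, P, x, y, b, hψ, hrR, hP, hx0P, hx, hxmin, hy, hyP, hb, hf, ?_, ?_, hQ, hcost⟩
  · have h1 : r < ψ y := not_le.mp fun hle => hyP (hmem.mpr ⟨hBX hy, hle⟩)
    have := hψ.le_of_mem hy (hBX hy)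
    linarith
  · intro v hv
    have := hψ.sub_le h (hmem.mp hv).1
    have := (hmem.mp hv).2
    linarith

theorem Rooted.hasTree [Fintype V] [Fintype E] {G : WGraph V E} {c : E → ℝ}
    (hc : ∀ e, 0 ≤ c e) {β : ℝ} (hβ : 0 < β) {N : ℕ} (hN : N ≠ 0) (X : Finset V) :
    ∀ {A : Finset V} {x0 : V} {f : V → ℝ}, G.mass c β X ≤ 2 ^ N * β → G.Rooted X A x0 f →
      G.HasTree c β (512 * N) X A x0 f := by
  induction X using Finset.strongInduction with
  | H X ih =>
  intro A x0 f hX h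
  by_cases htriv : ∃ v ∈ X, v ≠ x0
  swap
  · push Not at htriv
    have hXeq : X = {x0} := Finset.eq_singleton_iff_unique_mem.mpr ⟨h.root_mem, htriv⟩
    have hjoin : ∀ v ∈ X, G.JoinedIn ∅ x0 v 0 := fun v hv => by
      rw [htriv v hv]
      exact .refl G ∅ x0
    refine ⟨∅, 0, Finset.empty_subset _, by simp [hXeq], fun v hv => ?_, fun a ha => ?_,
      fun e he => ?_, ?_⟩
    · rw [htriv v hv, h.zero, mul_zero]
      exact .refl G ∅ x0
    · rw [htriv a (h.sub ha), h.zero]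
      exact .refl G ∅ x0
    · obtain ⟨h1, h2⟩ := mem_inside.mp he
      rw [htriv _ h1, htriv _ h2]
      exact .refl G ∅ x0
    · have := entropy_nonneg hβ (G.le_mass_of_mem hc hβ h.root_mem)
      simp only [Pi.zero_apply, mul_zero, zero_div, Finset.sum_const_zero]
      positivity
  obtain ⟨v, hv, hvne⟩ := htriv
  obtain ⟨z, hz, hzmax⟩ := X.exists_max_image f ⟨v, hv⟩
  have hΔ : 0 < f z := (h.pos hv hvne).trans_le (hzmax v hv)
  by_cases hhigh : ∃ t ∈ A, f z / 2 < f t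
  · obtain ⟨t, ht, hft⟩ := hhigh
    obtain ⟨s, hs, hsmax⟩ := A.exists_max_image f ⟨t, ht⟩
    have hts := hsmax t ht
    obtain ⟨ψ, r, P, x, y, b, hψ, hrR, hP, hx0P, hx, hxmin, hy, hyP, hb, hf, hyr, hvr, hQ,
      hcost⟩ := h.exists_petal hc hβ hN hX h.sub h.highway hs hsmax (R := f z / 4)
        (by linarith) (by linarith)
    have hPX : P ⊆ X := hP ▸ Finset.filter_subset _ _
    obtain ⟨hxA, hxP⟩ := Finset.mem_inter.mp hx
    have hhl : ∀ e ∈ G.inside P, G.hlen (A ∩ P) e = G.hlen A e := fun e he => by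
      obtain ⟨h1, h2⟩ := mem_inside.mp he
      simp [hlen, h1, h2]
    obtain ⟨f', hR', hfA', hfP'⟩ := hψ.exists_rooted h h.sub h.highway hP hx hxmin hx0P
      (μ := 1) (κ := -f x) one_pos (fun e he => by rw [hhl e he, one_mul])
      (fun e he => by
        rw [hhl e, one_mul]
        obtain ⟨h1, h2⟩ := mem_inside.mp he
        exact mem_inside.mpr ⟨(Finset.mem_inter.mp h1).2, (Finset.mem_inter.mp h2).2⟩)
      (fun e he => (hhl e he).le)
      (fun p hp => by linarith [hsmax p (Finset.mem_inter.mp hp).1])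
    have hlenb := G.len_le_hlen A b
    have hxr := hvr x hxP
    refine HasTree.glue (Δ := f z) hPX
      (ih _ (Finset.sdiff_ssubset hPX ⟨x, hxP⟩)
        ((G.mass_le_of_subset hc hβ Finset.sdiff_subset).trans hX) hQ)
      (ih P (Finset.ssubset_iff_subset_ne.mpr ⟨hPX, fun hE => hx0P (hE ▸ h.root_mem)⟩)
        ((G.mass_le_of_subset hc hβ hPX).trans hX) hR')
      hb (Finset.mem_sdiff.mpr ⟨h.sub hy, hyP⟩) hxP
      (Or.inl ⟨Finset.mem_sdiff.mpr ⟨hy, hyP⟩, rfl⟩) ?_ ?_ hzmax ?_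
    · intro v hv
      have h1 := hfP' v hv
      rw [hP, Finset.mem_filter] at hv
      linarith
    · intro a ha haP
      have haAP := Finset.mem_inter.mpr ⟨ha, haP⟩
      refine ⟨haAP, ?_⟩
      rw [hfA' a haAP]
      linarith
    · linarith
  · push Not at hhigh
    obtain ⟨B, hBX, hs, hsmax, hB⟩ := h.exists_highway z hz
    obtain ⟨ψ, r, P, x, y, b, hψ, hrR, hP, hx0P, hx, hxmin, hy, hyP, hb, hf, hyr, hvr, hQ,
      hcost⟩ := h.exists_petal hc hβ hN hX hBX hB hs hsmax (R := f z / 4)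
        (by linarith) (by linarith)
    have hPX : P ⊆ X := hP ▸ Finset.filter_subset _ _
    obtain ⟨hxB, hxP⟩ := Finset.mem_inter.mp hx
    have hAP : ∀ a ∈ A, a ∉ P := fun a ha haP => by
      linarith [hhigh a ha, hvr a haP]
    have hhl : ∀ e ∈ G.inside P, G.hlen A e = 2 * G.len e := fun e he =>
      if_neg fun hA => hAP _ hA.1 (mem_inside.mp he).1
    obtain ⟨f', hR', hfB', hfP'⟩ := hψ.exists_rooted h hBX hB hP hx hxmin hx0P
      (μ := 1 / 2) (κ := -(f z + f x) / 2) (by norm_num)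
      (fun e he => by
        rw [hhl e he]
        linarith [G.len_le_hlen (B ∩ P) e])
      (fun e he => by
        obtain ⟨h1, h2⟩ := mem_inside.mp he
        rw [hhl e (mem_inside.mpr ⟨(Finset.mem_inter.mp h1).2, (Finset.mem_inter.mp h2).2⟩),
          hlen, if_pos ⟨h1, h2⟩]
        ring)
      (fun e he => by
        rw [hhl e he]
        exact G.hlen_le_two_mul _ e)
      (fun p hp => by linarith)
    have hlenb := G.len_le_hlen A b
    refine HasTree.glue (Δ := f z) hPX
      (ih _ (Finset.sdiff_ssubset hPX ⟨x, hxP⟩)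
        ((G.mass_le_of_subset hc hβ Finset.sdiff_subset).trans hX) hQ)
      (ih P (Finset.ssubset_iff_subset_ne.mpr ⟨hPX, fun hE => hx0P (hE ▸ h.root_mem)⟩)
        ((G.mass_le_of_subset hc hβ hPX).trans hX) hR')
      hb (Finset.mem_sdiff.mpr ⟨hBX hy, hyP⟩) hxP (Or.inr rfl) ?_
      (fun a ha haP => absurd haP (hAP a ha)) hzmax ?_
    · intro v hv
      have h1 := hfP' v hv
      rw [hP, Finset.mem_filter] at hv
      linarith
    · linarith

theorem Connected.exists_rooted [Fintype V] [Fintype E] {G : WGraph V E} (hG : G.Connected)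
    (x0 : V) : ∃ f, G.Rooted Finset.univ {x0} x0 f := by
  let src : V → ℝ → Prop := fun v L => v = x0 ∧ L = 0
  let arc : V → V → ℝ → Prop := G.edgeArc Finset.univ fun e _ _ => G.hlen {x0} e
  have hwalk : ∀ {u v : V}, G.Walk u v → (∃ L, CostReach src arc u L) →
      ∃ L, CostReach src arc v L := by
    intro u v p
    induction p with
    | nil v => exact id
    | cons u v x e h p ih =>
      rintro ⟨L, hL⟩
      exact ih ⟨_, hL.step ⟨e, h, Finset.mem_univ _, Finset.mem_univ _, rfl⟩⟩
  obtain ⟨f, hf⟩ := CostReach.exists_potential (src := src) (arc := arc)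
    ((Set.finite_singleton (0 : ℝ)).subset (by rintro L ⟨v, -, rfl⟩; rfl))
    (G.finite_edgeArc _ _) (by rintro v L ⟨-, rfl⟩; exact le_rfl)
    (by rintro u v k ⟨e, -, -, -, rfl⟩; exact (G.hlen_pos _ e).le) Finset.univ
    (fun v _ => (hG x0 v).elim fun p => hwalk p ⟨0, .src ⟨rfl, rfl⟩⟩)
  replace hf := fun v => hf v (Finset.mem_univ v)
  have hnonneg : ∀ v L, CostReach src arc v L → 0 ≤ L := by
    intro v L hL
    induction hL with
    | src h => exact h.2.ge
    | step h h' ih =>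
      obtain ⟨e, -, -, -, rfl⟩ := h'
      exact add_nonneg ih (G.hlen_pos _ e).le
  refine ⟨f, Finset.subset_univ _, ?_, fun e u v he _ _ => ?_, fun v _ hne => ?_, by simp, ?_⟩
  · exact le_antisymm ((hf x0).2 _ (.src ⟨rfl, rfl⟩)) (hnonneg _ _ (hf x0).1)
  · exact (hf v).2 _ ((hf u).1.step ⟨e, he, Finset.mem_univ _, Finset.mem_univ _, rfl⟩)
  · obtain h1 | ⟨u, L, k, h1, h2, h3⟩ : src v (f v) ∨ ∃ u L k, CostReach src arc u L ∧
        arc u v k ∧ f v = L + k := by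
      have hv := (hf v).1
      generalize f v = y at hv
      cases hv with
      | src h => exact Or.inl h
      | step h h' => exact Or.inr ⟨_, _, _, h, h', rfl⟩
    · exact absurd h1.1 hne
    · obtain ⟨e, he, -, -, rfl⟩ := h2
      refine ⟨e, u, Finset.mem_univ _, he, ?_⟩
      have h4 := (hf u).2 L h1
      have h5 := (hf v).2 _
        ((hf u).1.step ⟨e, he, Finset.mem_univ _, Finset.mem_univ _, rfl⟩)
      linarith
  · intro a ha hne
    exact absurd (Finset.mem_singleton.mp ha) hne

theorem Connected.exists_spanningTree [Fintype V] [Fintype E] [Nonempty V] {G : WGraph V E}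
    (hG : G.Connected) {c : E → ℝ} (hc : ∀ e, 0 ≤ c e) {β : ℝ} (hβ : 0 < β) {N : ℕ}
    (hN : N ≠ 0) (hmass : G.mass c β Finset.univ ≤ 2 ^ N * β) :
    ∃ (T : Finset E) (D : E → ℝ), G.IsSpanningTree T ∧
      (∀ e, G.JoinedIn T (G.ends e).1 (G.ends e).2 (D e)) ∧
      ∑ e, c e * D e / G.len e ≤ 512 * N * entropy β (G.mass c β Finset.univ) := by
  obtain ⟨x0⟩ := ‹Nonempty V›
  obtain ⟨f, hf⟩ := hG.exists_rooted x0
  obtain ⟨T, D, -, hcard, hv, -, he, hsum⟩ := hf.hasTree hc hβ hN _ hmass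
  rw [inside_univ] at he hsum
  refine ⟨T, D, ⟨fun u v => ?_, hcard⟩, fun e => he e (Finset.mem_univ e), hsum⟩
  obtain ⟨p, -⟩ := (hv u (Finset.mem_univ u)).symm.trans (hv v (Finset.mem_univ v))
  exact ⟨p⟩

/-- The number of traversals of the edge `e` by a walk. -/
noncomputable def Walk.count {G : WGraph V E} (e : E) : ∀ {u v : V}, G.Walk u v → ℝ
  | _, _, .nil _ => 0
  | _, _, .cons _ _ _ e' _ p => (if e = e' then 1 else 0) + Walk.count e p

theorem Walk.count_nonneg {G : WGraph V E} (e : E) {u v : V} (p : G.Walk u v) :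
    0 ≤ p.count e := by
  induction p with
  | nil v => exact le_rfl
  | cons u v x e' h p ih =>
    simp only [Walk.count]
    split_ifs <;> linarith

theorem Walk.sum_count_mul_cons [Fintype E] {G : WGraph V E} (g : E → ℝ) {u v x : V} {e : E}
    (h : G.ends e = (u, v) ∨ G.ends e = (v, u)) (p : G.Walk v x) :
    ∑ e', (Walk.cons u v x e h p).count e' * g e' = g e + ∑ e', p.count e' * g e' := by
  simp [Walk.count, add_mul, Finset.sum_add_distrib]

theorem Walk.length_eq_sum [Fintype E] {G : WGraph V E} {u v : V} (p : G.Walk u v) :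
    p.length = ∑ e, p.count e * G.len e := by
  induction p with
  | nil v => simp [Walk.count, Walk.length]
  | cons u v x e h p ih => rw [sum_count_mul_cons, Walk.length, ih]

theorem Walk.joinedIn [Fintype E] {G : WGraph V E} {T : Finset E} {D : E → ℝ}
    (hD : ∀ e, G.JoinedIn T (G.ends e).1 (G.ends e).2 (D e)) {u v : V} (p : G.Walk u v) :
    G.JoinedIn T u v (∑ e, p.count e * D e) := by
  induction p with
  | nil v => simpa [Walk.count] using JoinedIn.refl G T v
  | cons u v x e h p ih =>
    rw [sum_count_mul_cons]
    refine JoinedIn.trans ?_ ih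
    have he := hD e
    rcases h with h | h <;> rw [h] at he
    exacts [he, he.symm]

theorem Connected.dist_pos [Finite E] {G : WGraph V E} (hG : G.Connected) {u v : V}
    (huv : u ≠ v) : 0 < G.dist u v := by
  have hne : ∀ {u v : V} (p : G.Walk u v), u ≠ v → ∃ e, G.len e ≤ p.length := by
    intro u v p huv
    cases p with
    | nil v => exact absurd rfl huv
    | cons u v x e h p => exact ⟨e, le_add_of_nonneg_right p.length_nonneg⟩
  obtain ⟨p⟩ := hG u v
  obtain ⟨e0, -⟩ := hne p huv
  have : Nonempty E := ⟨e0⟩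
  obtain ⟨e, he⟩ := Finite.exists_min G.len
  refine (G.len_pos e).trans_le (le_csInf ⟨_, p, rfl⟩ ?_)
  rintro _ ⟨q, rfl⟩
  obtain ⟨e', he'⟩ := hne q huv
  exact (he e').trans he'

theorem Connected.exists_walk_le [Finite E] {G : WGraph V E} (hG : G.Connected) (u v : V) :
    ∃ p : G.Walk u v, p.length ≤ 2 * G.dist u v := by
  by_cases huv : u = v
  · subst huv
    exact ⟨.nil u, by simp [Walk.length, dist_self]⟩
  · have hpos := hG.dist_pos huv
    obtain ⟨p⟩ := hG u v
    obtain ⟨_, ⟨q, rfl⟩, hq⟩ := exists_lt_of_csInf_lt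
      (s := {l | ∃ p : G.Walk u v, p.length = l}) ⟨_, p, rfl⟩
      (show G.dist u v < 2 * G.dist u v by linarith)
    exact ⟨q, hq.le⟩

theorem IsSpanningTree.dist_le [Fintype V] {G : WGraph V E} {T : Finset E}
    (hT : G.IsSpanningTree T) (u v : V) :
    G.dist u v ≤ (G.restrictE (T : Set E)).dist u v := by
  have hwalk : ∀ {u v : V} (p : (G.restrictE (T : Set E)).Walk u v),
      ∃ q : G.Walk u v, q.length = p.length := by
    intro u v p
    induction p with
    | nil v => exact ⟨.nil v, rfl⟩
    | cons u v x e h p ih =>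
      obtain ⟨q, hq⟩ := ih
      exact ⟨.cons u v x e.1 h q, congrArg (G.len e.1 + ·) hq⟩
  obtain ⟨p⟩ := hT.1 u v
  refine le_csInf ⟨_, p, rfl⟩ ?_
  rintro _ ⟨p, rfl⟩
  obtain ⟨q, hq⟩ := hwalk p
  exact hq ▸ dist_le_length q

/-- The number of edges that are not loops. -/
noncomputable def nonloops [Fintype E] (G : WGraph V E) : ℝ :=
  ∑ e, if (G.ends e).1 = (G.ends e).2 then 0 else 1

theorem Connected.nonloops_pos [Fintype V] [Fintype E] {G : WGraph V E} (hG : G.Connected)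
    (hV : 1 < Fintype.card V) : 0 < G.nonloops := by
  obtain ⟨e, he⟩ : ∃ e, (G.ends e).1 ≠ (G.ends e).2 := by
    by_contra! hloop
    have hwalk : ∀ {u v : V}, G.Walk u v → u = v := by
      intro u v p
      induction p with
      | nil v => rfl
      | cons u v x e h p ih =>
        have := hloop e
        rcases h with h | h <;> rw [h] at this
        exacts [Eq.trans this ih, this.symm.trans ih]
    obtain ⟨u, v, huv⟩ := Fintype.exists_pair_of_one_lt_card hV
    exact huv ((hG u v).elim hwalk)
  refine Finset.sum_pos' (fun e _ => ?_) ⟨e, Finset.mem_univ e, by rw [if_neg he]; exact one_pos⟩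
  split_ifs <;> norm_num

theorem IsSpanningTree.nonloops_le [Fintype V] [Fintype E] {G : WGraph V E} (hG : G.Connected)
    {T : Finset E} (hT : G.IsSpanningTree T) : G.nonloops ≤ ∑ e, G.stretchAKPW T e := by
  refine Finset.sum_le_sum fun e _ => ?_
  split_ifs with h
  · exact div_nonneg (dist_nonneg _ _ _) (dist_nonneg _ _ _)
  · exact (one_le_div (hG.dist_pos h)).mpr (hT.dist_le _ _)

theorem entropy_le {β s n : ℝ} (hβ : 0 < β) (hs : β ≤ s) (hsn : s ≤ n * β) :
    entropy β s ≤ n * β * (1 + Real.logb 2 n) := by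
  have h0 : 0 < s := hβ.trans_le hs
  have h1 : s / β ≤ n := (div_le_iff₀ hβ).mpr hsn
  have h2 : Real.logb 2 (s / β) ≤ Real.logb 2 n :=
    Real.logb_le_logb_of_le one_lt_two (div_pos h0 hβ) h1
  have h3 : 0 ≤ Real.logb 2 (s / β) :=
    Real.logb_nonneg one_lt_two ((one_le_div hβ).mpr hs)
  exact mul_le_mul hsn (by linarith) (by linarith) (h0.le.trans hsn)

/-- A spanning tree whose total stretch is `O((log n)²)` per edge that is not a loop. -/
theorem Connected.exists_sum_stretchAKPW_le [Fintype V] [Fintype E] {G : WGraph V E}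
    (hG : G.Connected) (hV : 1 < Fintype.card V) {N : ℕ} (hN : 2 * Fintype.card V ≤ 2 ^ N) :
    ∃ T : Finset E, G.IsSpanningTree T ∧ ∑ e, G.stretchAKPW T e ≤
      2048 * N * (1 + Real.logb 2 (2 * Fintype.card V)) * G.nonloops := by
  set d : E → ℝ := fun e => G.dist (G.ends e).1 (G.ends e).2 with hd
  have hd0 : ∀ e, 0 ≤ d e := fun e => G.dist_nonneg _ _
  choose p hp using fun e => hG.exists_walk_le (G.ends e).1 (G.ends e).2
  have hM := hG.nonloops_pos hV
  set n : ℝ := (Fintype.card V : ℝ) with hn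
  have hn0 : 0 < n := by
    rw [hn]
    exact_mod_cast one_pos.trans hV
  set c : E → ℝ := fun a => ∑ e, (p e).count a * G.len a / d e with hc
  have hc0 : ∀ a, 0 ≤ c a := fun a => Finset.sum_nonneg fun e _ =>
    div_nonneg (mul_nonneg ((p e).count_nonneg a) (G.len_pos a).le) (hd0 e)
  have hcsum : ∑ a, c a ≤ 2 * G.nonloops := by
    rw [hc, Finset.sum_comm, nonloops, Finset.mul_sum]
    refine Finset.sum_le_sum fun e _ => ?_
    rw [← Finset.sum_div, ← Walk.length_eq_sum]
    split_ifs with h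
    · have : d e = 0 := by
        rw [hd]
        dsimp only
        rw [h, dist_self]
      rw [this, div_zero, mul_zero]
    · rw [mul_one, div_le_iff₀ (hG.dist_pos h)]
      exact hp e
  set β : ℝ := 2 * G.nonloops / n with hβ
  have hβ0 : 0 < β := by positivity
  have hnβ : n * β = 2 * G.nonloops := by
    rw [hβ]
    field_simp
  have hmass : G.mass c β Finset.univ ≤ 2 * n * β := by
    rw [mass, inside_univ, Finset.card_univ, ← hn]
    linarith
  have hne : Nonempty V := Fintype.card_pos_iff.mp (one_pos.trans hV)
  have hN' : 2 * n ≤ 2 ^ N := by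
    rw [hn]
    exact_mod_cast hN
  have hN0 : N ≠ 0 := by
    rintro rfl
    rw [pow_zero] at hN
    omega
  obtain ⟨T, D, hT, hD, hsum⟩ := hG.exists_spanningTree hc0 hβ0 hN0
    (hmass.trans (mul_le_mul_of_nonneg_right hN' hβ0.le))
  refine ⟨T, hT, ?_⟩
  have hstretch : ∑ e, G.stretchAKPW T e ≤ ∑ a, c a * D a / G.len a := by
    have hcomm : ∑ a, c a * D a / G.len a = ∑ e, (∑ a, (p e).count a * D a) / d e := by
      simp only [hc, Finset.sum_mul, Finset.sum_div]
      rw [Finset.sum_comm]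
      refine Finset.sum_congr rfl fun e _ => Finset.sum_congr rfl fun a _ => ?_
      have := (G.len_pos a).ne'
      field_simp
    rw [hcomm]
    exact Finset.sum_le_sum fun e _ =>
      div_le_div_of_nonneg_right ((p e).joinedIn hD).dist_le (hd0 e)
  have hent := entropy_le hβ0 (G.le_mass_of_mem hc0 hβ0 (Finset.mem_univ hne.some)) hmass
  calc ∑ e, G.stretchAKPW T e
      ≤ 512 * N * entropy β (G.mass c β Finset.univ) := hstretch.trans hsum
    _ ≤ 512 * N * (2 * n * β * (1 + Real.logb 2 (2 * n))) := by gcongr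
    _ = 512 * N * (2 * (n * β) * (1 + Real.logb 2 (2 * n))) := by ring
    _ = 2048 * N * (1 + Real.logb 2 (2 * n)) * G.nonloops := by
      rw [hnβ]
      ring

end WGraph

theorem Real.one_fourth_le_log_log {x : ℝ} (hx : 4 ≤ x) : 1 / 4 ≤ Real.log (Real.log x) := by
  have h2 : 0.69 < Real.log 2 := by linarith [Real.log_two_gt_d9]
  have h4 : Real.log 4 = 2 * Real.log 2 := by
    rw [show (4 : ℝ) = 2 ^ 2 by norm_num, Real.log_pow]
    norm_num
  have h : 4 / 3 ≤ Real.log x := by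
    have := Real.log_le_log (by norm_num) hx
    linarith
  have h0 : 0 < Real.log x := by linarith
  have h1 := Real.one_sub_inv_le_log_of_pos h0
  have h3 : (Real.log x)⁻¹ ≤ 3 / 4 := by
    rw [inv_le_comm₀ h0 (by norm_num)]
    linarith
  linarith

theorem clog_mul_one_add_logb_le {n : ℕ} (hn : 4 ≤ n) :
    (Nat.clog 2 (2 * n) : ℝ) * (1 + Real.logb 2 (2 * n)) ≤
      64 * (Real.log n ^ 2 * Real.log (Real.log n)) := by
  have hn' : (4 : ℝ) ≤ n := by exact_mod_cast hn
  have hn0 : (0 : ℝ) < n := by linarith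
  have hlogb : Real.logb 2 (2 * n) = 1 + Real.logb 2 n := by
    rw [Real.logb_mul two_ne_zero hn0.ne', Real.logb_self_eq_one one_lt_two]
  have h2 : 2 ≤ Real.logb 2 n := by
    rw [Real.le_logb_iff_rpow_le one_lt_two hn0]
    norm_num
    exact hn
  have hclog : (Nat.clog 2 (2 * n) : ℝ) ≤ Real.logb 2 (2 * n) + 1 := by
    have h1 : Nat.clog 2 (2 * n) - 1 < Nat.clog 2 (2 * n) :=
      Nat.sub_one_lt (Nat.clog_pos one_lt_two (by omega)).ne'
    have h3 : 2 ^ (Nat.clog 2 (2 * n) - 1) < 2 * n :=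
      Nat.pow_pred_clog_lt_self one_lt_two (by omega)
    have h4 : ((Nat.clog 2 (2 * n) - 1 : ℕ) : ℝ) ≤ Real.logb 2 (2 * n) := by
      rw [Real.le_logb_iff_rpow_le one_lt_two (by positivity), Real.rpow_natCast]
      exact_mod_cast h3.le
    have h5 : Nat.clog 2 (2 * n) = (Nat.clog 2 (2 * n) - 1) + 1 := by omega
    rw [h5]
    push_cast
    linarith
  have hlog : Real.logb 2 n ≤ 2 * Real.log n := by
    have := Real.log_two_gt_d9
    rw [Real.logb, div_le_iff₀ (by linarith)]
    nlinarith [Real.log_nonneg (show (1 : ℝ) ≤ n by linarith)]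
  calc (Nat.clog 2 (2 * n) : ℝ) * (1 + Real.logb 2 (2 * n))
      ≤ (2 * Real.logb 2 n) * (2 * Real.logb 2 n) := by
        gcongr <;> linarith
    _ ≤ (2 * (2 * Real.log n)) * (2 * (2 * Real.log n)) := by
        gcongr
    _ = 64 * (Real.log n ^ 2 * (1 / 4)) := by ring
    _ ≤ 64 * (Real.log n ^ 2 * Real.log (Real.log n)) := by
        gcongr
        exact Real.one_fourth_le_log_log hn'

/-- An `O((log n)² log log n)`-approximation for the minimum
average-stretch (AKPW stretch) spanning tree problem: there is a spanning tree
`T` whose average AKPW stretch is within the factor `C (log n)² log log n` of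
that of every subgraph spanning tree `T'`. -/
theorem mast_approximation :
    ∃ C : ℝ, ∀ (V E : Type) [Fintype V] [Fintype E] (G : WGraph V E),
      G.Connected → 4 ≤ Fintype.card V →
      ∃ T : Finset E, G.IsSpanningTree T ∧
        ∀ T' : Finset E, G.IsSpanningTree T' →
          G.avestretchAKPW T ≤
            C * Real.log (Fintype.card V) ^ 2 *
              Real.log (Real.log (Fintype.card V)) *
                G.avestretchAKPW T' := by
  refine ⟨131072, fun V E _ _ G hG hV => ?_⟩
  obtain ⟨T, hT, hsum⟩ := hG.exists_sum_stretchAKPW_le (by omega)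
    (Nat.le_pow_clog one_lt_two (2 * Fintype.card V))
  refine ⟨T, hT, fun T' hT' => ?_⟩
  have hle := hT'.nonloops_le hG
  have hM := hG.nonloops_pos (by omega)
  have hlog := clog_mul_one_add_logb_le hV
  have hloglog := Real.one_fourth_le_log_log (x := Fintype.card V) (by exact_mod_cast hV)
  rw [WGraph.avestretchAKPW, WGraph.avestretchAKPW, ← mul_div_assoc]
  refine div_le_div_of_nonneg_right ?_ (Nat.cast_nonneg _)
  calc ∑ e, G.stretchAKPW T e
      ≤ 2048 * (Nat.clog 2 (2 * Fintype.card V) *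
          (1 + Real.logb 2 (2 * Fintype.card V))) * G.nonloops := by
        rw [← mul_assoc]
        exact hsum
    _ ≤ 2048 * (64 * (Real.log (Fintype.card V) ^ 2 *
          Real.log (Real.log (Fintype.card V)))) * G.nonloops := by gcongr
    _ = 131072 * Real.log (Fintype.card V) ^ 2 * Real.log (Real.log (Fintype.card V)) *
          G.nonloops := by ring
    _ ≤ 131072 * Real.log (Fintype.card V) ^ 2 * Real.log (Real.log (Fintype.card V)) *
          ∑ e, G.stretchAKPW T' e := by gcongr
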